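/- Let A be a noetherian commutative ring and I ⊆ A an ideal. An object M of D_I(A) is a compact object of the triangulated category D_I(A) if and only if M is isomorphic, in D(A), to a bounded complex of finitely generated projective A-modules. -/

import Mathlib

/-!
STATEMENT 9: Let `A` be a noetherian commutative ring and `I ⊆ A` an ideal. An object `M`
of `D_I(A)` is a compact object of the triangulated category `D_I(A)` if and only if `M` is
isomorphic, in `D(A)`, to a bounded complex of finitely generated projective `A`-modules.
-/

universe w u

open CategoryTheory Limits

/-- An `A`-module `M` is `I`-torsion if every element of `M` is annihilated by some power
of `I`. -/
def IsTorsionWrt {A : Type u} [CommRing A] (I : Ideal A) (M : Type*) [AddCommGroup M]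
    [Module A M] : Prop :=
  ∀ m : M, ∃ k : ℕ, ∀ a ∈ I ^ k, a • m = 0

/-- `D_I(A)`: the class of objects of the unbounded derived category `D(A)` all of whose
homology modules are `I`-torsion. -/
def DTor {A : Type u} [CommRing A] [HasDerivedCategory.{w} (ModuleCat.{u} A)] (I : Ideal A) :
    Set (DerivedCategory (ModuleCat.{u} A)) :=
  {M | ∀ n : ℤ, IsTorsionWrt I ((DerivedCategory.homologyFunctor (ModuleCat.{u} A) n).obj M)}

/-- The canonical comparison map `⨁ⱼ Hom(E, Y j) →+ Hom(E, ∐ Y)`. -/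
noncomputable def coproductComparison {T : Type u} [Category.{w} T] [Preadditive T]
    (E : T) {J : Type u} [DecidableEq J] (Y : J → T) [HasCoproduct Y] :
    DirectSum J (fun j => E ⟶ Y j) →+ (E ⟶ ∐ Y) :=
  DirectSum.toAddMonoid (fun j => AddMonoidHom.mk' (fun f => f ≫ Sigma.ι Y j)
    (fun f g => by simp [Preadditive.add_comp]))

/-- An object `E` of a full subcategory `S` (whose Hom's and coproducts are computed in the
ambient category `T`) is a compact object of `S` if `Hom(E, −)` commutes with arbitrary
coproducts of families of objects of `S`. -/
def IsCompactObjIn {T : Type u} [Category.{w} T] [Preadditive T] (S : Set T) (E : T) : Prop :=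
  ∀ (J : Type u) [DecidableEq J] (Y : J → T) [HasCoproduct Y],
    (∀ j : J, Y j ∈ S) → Function.Bijective (coproductComparison E Y)

/-- A cochain complex of `A`-modules is a bounded complex of finitely generated projective
modules if all its components are finitely generated projective and all but finitely many
components vanish. -/
def IsBoundedComplexOfFinProj {A : Type u} [CommRing A]
    (K : CochainComplex (ModuleCat.{u} A) ℤ) : Prop :=
  (∀ n : ℤ, Module.Finite A (K.X n) ∧ Module.Projective A (K.X n)) ∧
    ∃ a b : ℤ, ∀ n : ℤ, (n < a ∨ b < n) → IsZero (K.X n)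

namespace IsTorsionWrt

variable {A : Type u} [CommRing A] {I : Ideal A} {M N : Type*} [AddCommGroup M] [Module A M]
  [AddCommGroup N] [Module A N]

lemma of_injective (h : IsTorsionWrt I N) (f : M →ₗ[A] N) (hf : Function.Injective f) :
    IsTorsionWrt I M := fun m => by
  obtain ⟨k, hk⟩ := h (f m)
  exact ⟨k, fun a ha => hf (by rw [map_smul, hk a ha, map_zero])⟩

lemma of_surjective (h : IsTorsionWrt I M) (f : M →ₗ[A] N) (hf : Function.Surjective f) :
    IsTorsionWrt I N := fun n => by
  obtain ⟨m, rfl⟩ := hf n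
  obtain ⟨k, hk⟩ := h m
  exact ⟨k, fun a ha => by rw [← map_smul, hk a ha, map_zero]⟩

lemma of_subsingleton [Subsingleton M] : IsTorsionWrt I M :=
  fun _ => ⟨0, fun _ _ => Subsingleton.elim _ _⟩

/-- A finitely generated torsion module is annihilated by a power of the ideal. -/
lemma exists_pow_smul_eq_zero [Module.Finite A M] (h : IsTorsionWrt I M) :
    ∃ k : ℕ, ∀ a ∈ I ^ k, ∀ m : M, a • m = 0 := by
  obtain ⟨s, hs⟩ := Module.Finite.fg_top (R := A) (M := M)
  choose k hk using h
  refine ⟨s.sup k, fun a ha m => ?_⟩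
  have hm : m ∈ Submodule.span A (s : Set M) := hs ▸ Submodule.mem_top
  induction hm using Submodule.span_induction with
  | mem x hx => exact hk x a (Ideal.pow_le_pow_right (Finset.le_sup hx) ha)
  | zero => simp
  | add x y _ _ hx hy => rw [smul_add, hx, hy, add_zero]
  | smul r x _ hx => rw [smul_comm, hx, smul_zero]

end IsTorsionWrt

section Injective

variable {A : Type u} [CommRing A]

/-- The submodule of elements annihilated by a power of `I`. -/
def torsionSubmodule (I : Ideal A) (M : Type*) [AddCommGroup M] [Module A M] :
    Submodule A M where
  carrier := {m | ∃ k : ℕ, ∀ a ∈ I ^ k, a • m = 0}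
  zero_mem' := ⟨0, by simp⟩
  add_mem' := by
    rintro x y ⟨k, hk⟩ ⟨l, hl⟩
    refine ⟨max k l, fun a ha => ?_⟩
    rw [smul_add, hk a (Ideal.pow_le_pow_right (le_max_left _ _) ha),
      hl a (Ideal.pow_le_pow_right (le_max_right _ _) ha), add_zero]
  smul_mem' := by
    rintro c x ⟨k, hk⟩
    exact ⟨k, fun a ha => by rw [smul_comm, hk a ha, smul_zero]⟩

lemma isTorsionWrt_torsionSubmodule (I : Ideal A) (M : Type*) [AddCommGroup M] [Module A M] :
    IsTorsionWrt I (torsionSubmodule I M) := by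
  rintro ⟨m, k, hk⟩
  exact ⟨k, fun a ha => Subtype.ext (hk a ha)⟩

/-- Over a noetherian ring, the torsion submodule of an injective module is injective. -/
lemma baer_torsionSubmodule [IsNoetherianRing A] (I : Ideal A) (J : Type u) [AddCommGroup J]
    [Module A J] (hJ : Module.Injective A J) : Module.Baer A (torsionSubmodule I J) := by
  intro 𝔞 g
  have htors : IsTorsionWrt I (LinearMap.range g) :=
    (isTorsionWrt_torsionSubmodule I J).of_injective (LinearMap.range g).subtype
      Subtype.val_injective
  obtain ⟨k, hk⟩ := htors.exists_pow_smul_eq_zero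
  obtain ⟨n, hn⟩ := Ideal.exists_pow_inf_eq_pow_smul I (𝔞 : Submodule A A)
  have hker : ∀ x (hx : x ∈ 𝔞), x ∈ I ^ (n + k) → g ⟨x, hx⟩ = 0 := by
    intro x hx hxI
    have h1 : x ∈ I ^ (n + k) • (⊤ : Submodule A A) ⊓ 𝔞 := ⟨by simpa using hxI, hx⟩
    rw [hn (n + k) (by omega), Nat.add_sub_cancel_left] at h1
    have h2 : x ∈ I ^ k • (𝔞 : Submodule A A) := Submodule.smul_mono le_rfl inf_le_right h1
    have key : ∀ y ∈ I ^ k • (𝔞 : Submodule A A), ∃ hy : y ∈ 𝔞, g ⟨y, hy⟩ = 0 := by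
      intro y hy
      refine Submodule.smul_induction_on hy (fun r hr z hz => ?_) (fun y z hy hz => ?_)
      · refine ⟨𝔞.mul_mem_left r hz, ?_⟩
        have : g ⟨r • z, 𝔞.mul_mem_left r hz⟩ = r • g ⟨z, hz⟩ := by
          rw [← map_smul]; rfl
        rw [this]
        exact congrArg Subtype.val (hk r hr ⟨g ⟨z, hz⟩, LinearMap.mem_range_self _ _⟩)
      · obtain ⟨hy, hy'⟩ := hy
        obtain ⟨hz, hz'⟩ := hz
        refine ⟨𝔞.add_mem hy hz, ?_⟩
        have : g ⟨y + z, 𝔞.add_mem hy hz⟩ = g ⟨y, hy⟩ + g ⟨z, hz⟩ := by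
          rw [← map_add]; rfl
        rw [this, hy', hz', add_zero]
    exact (key x h2).2
  let q : A →ₗ[A] A ⧸ I ^ (n + k) := (I ^ (n + k)).mkQ
  let p : 𝔞 →ₗ[A] A ⧸ I ^ (n + k) := q ∘ₗ 𝔞.subtype
  have hle : LinearMap.ker p ≤ LinearMap.ker ((torsionSubmodule I J).subtype ∘ₗ g) := by
    rintro ⟨x, hx⟩ h
    have hx' : x ∈ I ^ (n + k) := by
      exact (Submodule.Quotient.mk_eq_zero _).1 h
    simp [hker x hx hx']
  obtain ⟨h, hh⟩ := hJ.out (((LinearMap.ker p).liftQ p le_rfl)) (by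
      rw [← LinearMap.ker_eq_bot]
      exact Submodule.ker_liftQ_eq_bot _ _ _ le_rfl)
    ((LinearMap.ker p).liftQ _ hle)
  have hmem : ∀ x : A, h (q x) ∈ torsionSubmodule I J := by
    intro x
    refine ⟨n + k, fun a ha => ?_⟩
    rw [← map_smul, ← map_smul]
    have : q (a • x) = 0 := by
      simp only [q, Submodule.mkQ_apply, Submodule.Quotient.mk_eq_zero]
      exact Ideal.mul_mem_right _ _ ha
    rw [this, map_zero]
  refine ⟨(h ∘ₗ q).codRestrict _ hmem, fun x hx => Subtype.ext ?_⟩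
  exact hh ((LinearMap.ker p).mkQ ⟨x, hx⟩)

/-- Over a noetherian ring, a torsion module embeds into an injective torsion module. -/
lemma exists_injective_torsion_hull [IsNoetherianRing A] {I : Ideal A} {H : Type u}
    [AddCommGroup H] [Module A H] (hH : IsTorsionWrt I H) :
    ∃ E : ModuleCat.{u} A, IsTorsionWrt I E ∧ Module.Baer A E ∧
      ∃ j : H →ₗ[A] E, Function.Injective j := by
  let J := Injective.under (ModuleCat.of A H)
  let ι : ModuleCat.of A H ⟶ J := Injective.ι _
  have hι : Function.Injective ι.hom := (ModuleCat.mono_iff_injective ι).1 inferInstance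
  have hJ : Module.Injective A J :=
    (Module.injective_iff_injective_object A J).2 (inferInstanceAs (Injective J))
  refine ⟨ModuleCat.of A (torsionSubmodule I J), isTorsionWrt_torsionSubmodule I J,
    baer_torsionSubmodule I J hJ, ι.hom.codRestrict _ (fun x => ?_), fun x y hxy => hι ?_⟩
  · obtain ⟨k, hk⟩ := hH x
    exact ⟨k, fun a ha => by
      have := congrArg ι.hom (hk a ha)
      rwa [map_smul, map_zero] at this⟩
  · exact congrArg Subtype.val hxy

/-- Over a noetherian ring, direct sums of injective modules are injective. -/
lemma baer_directSum [IsNoetherianRing A] {J : Type*} [DecidableEq J] (E : J → Type*)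
    [∀ j, AddCommGroup (E j)] [∀ j, Module A (E j)] (hE : ∀ j, Module.Baer A (E j)) :
    Module.Baer A (DirectSum J E) := by
  classical
  intro 𝔞 g
  obtain ⟨s, hs⟩ := Module.Finite.fg_top (R := A) (M := 𝔞)
  choose h hh using fun j => hE j 𝔞 (DirectSum.component A J E j ∘ₗ g)
  let F : Finset J := s.biUnion (fun x => (g x).support)
  have hF : ∀ j ∉ F, DirectSum.component A J E j ∘ₗ g = 0 := by
    intro j hj
    rw [← LinearMap.ker_eq_top, eq_top_iff, ← hs, Submodule.span_le]
    intro x hx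
    simp only [F, Finset.mem_biUnion, not_exists, not_and, DFinsupp.mem_support_iff,
      not_not] at hj
    exact hj x hx
  refine ⟨LinearMap.toSpanSingleton A _ (∑ j ∈ F, DirectSum.lof A J E j (h j 1)),
    fun x hx => DirectSum.ext_component A fun j => ?_⟩
  have h1 := hh j x hx
  simp only [LinearMap.toSpanSingleton_apply, map_smul, map_sum]
  have h2 : ∑ i ∈ F, DirectSum.component A J E j (DirectSum.lof A J E i (h i 1)) =
      if j ∈ F then h j 1 else 0 := by
    rw [← Finset.sum_ite_eq' F j (fun i => h j 1)]
    refine Finset.sum_congr rfl fun i _ => ?_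
    split_ifs with hij
    · subst hij; exact DirectSum.component.lof_self A _ _
    · rw [DirectSum.component.of, dif_neg hij]
  rw [h2]
  split_ifs with hj
  · rw [← map_smul, smul_eq_mul, mul_one, h1]; rfl
  · rw [smul_zero]
    exact (LinearMap.congr_fun (hF j hj) ⟨x, hx⟩).symm

/-- Injectivity against arbitrary monomorphisms, in terms of Baer's criterion. -/
lemma Module.Baer.exists_extend {E : ModuleCat.{u} A} (hE : Module.Baer A E)
    {X Y : ModuleCat.{u} A} (i : X →ₗ[A] Y) (hi : Function.Injective i) (f : X →ₗ[A] E) :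
    ∃ g : Y →ₗ[A] E, g ∘ₗ i = f := by
  obtain ⟨g, hg⟩ := hE.injective.out i hi f
  exact ⟨g, LinearMap.ext hg⟩

end Injective

section Projective

variable {A : Type u} [CommRing A]

open TensorProduct IsLocalRing in
/-- If all functionals on `k ⊗ B` extend along `k ⊗ l`, the latter is injective. -/
lemma lTensor_residueField_injective {R : Type u} [CommRing R] [IsLocalRing R]
    {B F : Type u} [AddCommGroup B] [Module R B] [AddCommGroup F] [Module R F] (l : B →ₗ[R] F)
    (h : ∀ φ : B →ₗ[R] ResidueField R, ∃ ψ : F →ₗ[R] ResidueField R, ψ ∘ₗ l = φ) :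
    Function.Injective (l.lTensor (ResidueField R)) := by
  rw [injective_iff_map_eq_zero]
  intro x hx
  rw [← Module.forall_dual_apply_eq_zero_iff (ResidueField R)]
  intro f
  let φ : B →ₗ[R] ResidueField R := f.restrictScalars R ∘ₗ TensorProduct.mk R _ B 1
  obtain ⟨ψ, hψ⟩ := h φ
  let g : ResidueField R ⊗[R] F →ₗ[R] ResidueField R :=
    TensorProduct.lift ((LinearMap.mul R (ResidueField R)).compl₂ ψ)
  have hfg : f.restrictScalars R = g ∘ₗ l.lTensor (ResidueField R) := by
    apply TensorProduct.ext'
    intro k b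
    have h1 : ψ (l b) = f (1 ⊗ₜ b) := LinearMap.congr_fun hψ b
    have h2 : f (k ⊗ₜ[R] b) = k * f (1 ⊗ₜ b) := by
      rw [← smul_eq_mul, ← map_smul, TensorProduct.smul_tmul', smul_eq_mul, mul_one]
    simp [g, h1, h2]
  have := LinearMap.congr_fun hfg x
  simpa [hx] using this

/-- The residue field of `A` at a maximal ideal, as an `A`-module. -/
noncomputable abbrev residueFieldModule (m : Ideal A) [m.IsMaximal] : ModuleCat.{u} A :=
  ModuleCat.of A (IsLocalRing.ResidueField (Localization.AtPrime m))

lemma isUnit_algebraMap_residueField (m : Ideal A) [m.IsMaximal] {a : A} (ha : a ∉ m) :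
    IsUnit (algebraMap A (IsLocalRing.ResidueField (Localization.AtPrime m)) a) := by
  rw [IsScalarTower.algebraMap_apply A (Localization.AtPrime m)]
  exact (IsLocalization.map_units (Localization.AtPrime m) (⟨a, ha⟩ : m.primeCompl)).map _

lemma isTorsionWrt_residueFieldModule {I : Ideal A} (m : Ideal A) [m.IsMaximal] (h : I ≤ m) :
    IsTorsionWrt I (residueFieldModule m) := by
  intro x
  refine ⟨1, fun a ha => ?_⟩
  have h1 : algebraMap A (IsLocalRing.ResidueField (Localization.AtPrime m)) a = 0 := by
    rw [IsScalarTower.algebraMap_apply A (Localization.AtPrime m)]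
    rw [IsLocalRing.ResidueField.algebraMap_eq, IsLocalRing.residue_eq_zero_iff]
    exact (IsLocalization.AtPrime.to_map_mem_maximal_iff _ m a).2 (h (by simpa using ha))
  change a • (x : IsLocalRing.ResidueField (Localization.AtPrime m)) = 0
  rw [Algebra.smul_def, h1, zero_mul]

/-- Local criterion: the quotient of a finite projective module by a submodule is projective
if all maps from the submodule to residue fields extend. -/
lemma projective_quotient_of_extend [IsNoetherianRing A] {F : Type u} [AddCommGroup F] [Module A F]
    [Module.Finite A F] [Module.Projective A F] (B : Submodule A F)
    (h : ∀ (m : Ideal A) [m.IsMaximal] (φ : B →ₗ[A] residueFieldModule m),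
      ∃ ψ : F →ₗ[A] residueFieldModule m, ψ ∘ₗ B.subtype = φ) :
    Module.Projective A (F ⧸ B) := by
  have : Module.FinitePresentation A (F ⧸ B) := Module.finitePresentation_of_finite A _
  refine Module.projective_of_localization_maximal fun m hm => ?_
  let S := m.primeCompl
  let R := Localization.AtPrime m
  let l : LocalizedModule S B →ₗ[R] LocalizedModule S F := LocalizedModule.map S B.subtype
  let g : LocalizedModule S F →ₗ[R] LocalizedModule S (F ⧸ B) := LocalizedModule.map S B.mkQ
  have : Module.Free R (LocalizedModule S F) := Module.free_of_flat_of_isLocalRing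
  have hl : Function.Injective (l.lTensor (IsLocalRing.ResidueField R)) := by
    refine lTensor_residueField_injective l fun φ => ?_
    let ι := LocalizedModule.mkLinearMap S B
    let κ := LocalizedModule.mkLinearMap S F
    obtain ⟨ψ, hψ⟩ := h m (φ.restrictScalars A ∘ₗ ι)
    have hu : ∀ x : S, IsUnit (algebraMap A
        (Module.End A (IsLocalRing.ResidueField (Localization.AtPrime m))) x) := fun x => by
      have := (isUnit_algebraMap_residueField m x.2).map
        (Algebra.lmul A (IsLocalRing.ResidueField (Localization.AtPrime m)))
      rwa [AlgHom.commutes] at this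
    let ψ' := IsLocalizedModule.lift S κ ψ hu
    refine ⟨ψ'.extendScalarsOfIsLocalization S R, ?_⟩
    apply LinearMap.restrictScalars_injective A
    apply IsLocalizedModule.ext S ι hu
    ext b
    have h1 : l (ι b) = κ b := IsLocalizedModule.map_apply S ι κ B.subtype b
    have h2 : ψ b = φ (ι b) := LinearMap.congr_fun hψ b
    have h3 : ψ' (κ b) = ψ b := IsLocalizedModule.lift_apply S κ ψ hu b
    change ψ' (l (ι b)) = φ (ι b)
    rw [h1, h3, h2]
  have : Module.Free R (LocalizedModule S (F ⧸ B)) :=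
    Module.free_of_lTensor_residueField_injective l g
      (LocalizedModule.map_surjective S _ B.mkQ_surjective)
      (LocalizedModule.map_exact S _ _ (LinearMap.exact_subtype_mkQ B)) hl
  infer_instance

end Projective

section Elements

variable {A : Type u} [CommRing A] {ι : Type*} {c : ComplexShape ι}
  (K L : HomologicalComplex (ModuleCat.{u} A) c)

lemma iCycles_injective (j : ι) : Function.Injective (K.iCycles j).hom :=
  (ModuleCat.mono_iff_injective _).1 inferInstance

lemma homologyπ_surjective (j : ι) : Function.Surjective (K.homologyπ j).hom :=
  (ModuleCat.epi_iff_surjective _).1 inferInstance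

lemma homologyι_injective (j : ι) : Function.Injective (K.homologyι j).hom :=
  (ModuleCat.mono_iff_injective _).1 inferInstance

lemma pOpcycles_surjective (j : ι) : Function.Surjective (K.pOpcycles j).hom :=
  (ModuleCat.epi_iff_surjective _).1 inferInstance

lemma d_iCycles (j k : ι) (z : K.cycles j) : (K.d j k).hom ((K.iCycles j).hom z) = 0 := by
  have := K.iCycles_d j k
  exact congr($(this).hom z)

lemma exists_iCycles_eq {j k : ι} (hk : c.next j = k) (x : K.X j) (hx : (K.d j k).hom x = 0) :
    ∃ z, (K.iCycles j).hom z = x := by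
  have h := ShortComplex.exact_of_f_is_kernel (ShortComplex.mk _ _ (K.iCycles_d j k))
    (K.cyclesIsKernel j k hk)
  exact (ShortComplex.moduleCat_exact_iff _).1 h x hx

lemma homologyπ_eq_zero_iff {i j : ι} (hi : c.prev j = i) (z : K.cycles j) :
    (K.homologyπ j).hom z = 0 ↔ ∃ y : K.X i, (K.d i j).hom y = (K.iCycles j).hom z := by
  have h := ShortComplex.exact_of_g_is_cokernel (ShortComplex.mk _ _ (K.toCycles_comp_homologyπ i j))
    (K.homologyIsCokernel i j hi)
  have h1 (y : K.X i) : (K.iCycles j).hom ((K.toCycles i j).hom y) = (K.d i j).hom y :=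
    congr($(K.toCycles_i i j).hom y)
  constructor
  · intro hz
    obtain ⟨y, hy⟩ := (ShortComplex.moduleCat_exact_iff _).1 h z hz
    refine ⟨y, ?_⟩
    rw [← h1]
    exact congrArg _ hy
  · rintro ⟨y, hy⟩
    have : (K.toCycles i j).hom y = z := iCycles_injective K j (by rw [h1, hy])
    rw [← this]
    exact congr($(K.toCycles_comp_homologyπ i j).hom y)

lemma pOpcycles_eq_zero_iff {i j : ι} (hi : c.prev j = i) (x : K.X j) :
    (K.pOpcycles j).hom x = 0 ↔ ∃ y : K.X i, (K.d i j).hom y = x := by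
  have h := ShortComplex.exact_of_g_is_cokernel (ShortComplex.mk _ _ (K.d_pOpcycles i j))
    (K.opcyclesIsCokernel i j hi)
  constructor
  · intro hx
    exact (ShortComplex.moduleCat_exact_iff _).1 h x hx
  · rintro ⟨y, rfl⟩
    exact congr($(K.d_pOpcycles i j).hom y)

variable {K L}

lemma homologyMap_homologyπ (f : K ⟶ L) (j : ι) (z : K.cycles j) :
    (HomologicalComplex.homologyMap f j).hom ((K.homologyπ j).hom z) =
      (L.homologyπ j).hom ((HomologicalComplex.cyclesMap f j).hom z) :=
  congr($(HomologicalComplex.homologyπ_naturality f j).hom z)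

lemma iCycles_cyclesMap (f : K ⟶ L) (j : ι) (z : K.cycles j) :
    (L.iCycles j).hom ((HomologicalComplex.cyclesMap f j).hom z) =
      (f.f j).hom ((K.iCycles j).hom z) :=
  congr($(HomologicalComplex.cyclesMap_i f j).hom z)

lemma f_d_apply (f : K ⟶ L) (i j : ι) (x : K.X i) :
    (L.d i j).hom ((f.f i).hom x) = (f.f j).hom ((K.d i j).hom x) :=
  congr($(f.comm i j).hom x)

lemma f_apply_congr {f g : K ⟶ L} (h : f = g) (j : ι) (x : K.X j) :
    (f.f j).hom x = (g.f j).hom x := by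
  rw [h]

lemma quasiIsoAt_of_elements (f : K ⟶ L) {i j k : ι} (hi : c.prev j = i) (hk : c.next j = k)
    (inj : ∀ x : K.X j, (K.d j k).hom x = 0 → ∀ y : L.X i, (L.d i j).hom y = (f.f j).hom x →
      ∃ z : K.X i, (K.d i j).hom z = x)
    (surj : ∀ y : L.X j, (L.d j k).hom y = 0 → ∃ (x : K.X j) (z : L.X i), (K.d j k).hom x = 0 ∧
      (f.f j).hom x + (L.d i j).hom z = y) : QuasiIsoAt f j := by
  rw [quasiIsoAt_iff_isIso_homologyMap]
  have : Mono (HomologicalComplex.homologyMap f j) := by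
    rw [ModuleCat.mono_iff_injective]
    refine (injective_iff_map_eq_zero (HomologicalComplex.homologyMap f j).hom).2 fun h hh => ?_
    obtain ⟨z, rfl⟩ := homologyπ_surjective K j h
    rw [homologyMap_homologyπ, homologyπ_eq_zero_iff L hi] at hh
    obtain ⟨y, hy⟩ := hh
    rw [iCycles_cyclesMap] at hy
    rw [homologyπ_eq_zero_iff K hi]
    exact inj _ (d_iCycles K j k z) y hy
  have : Epi (HomologicalComplex.homologyMap f j) := by
    rw [ModuleCat.epi_iff_surjective]
    intro h
    obtain ⟨z, rfl⟩ := homologyπ_surjective L j h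
    obtain ⟨x, y, hx, hxy⟩ := surj _ (d_iCycles L j k z)
    obtain ⟨z', rfl⟩ := exists_iCycles_eq K hk x hx
    refine ⟨(K.homologyπ j).hom z', ?_⟩
    change (HomologicalComplex.homologyMap f j).hom ((K.homologyπ j).hom z') = _
    rw [homologyMap_homologyπ, ← sub_eq_zero, ← map_sub, homologyπ_eq_zero_iff L hi]
    refine ⟨-y, ?_⟩
    rw [map_sub, iCycles_cyclesMap, ← hxy, map_neg]
    abel
  exact isIso_of_mono_of_epi _

lemma exists_of_quasiIsoAt_of_d_eq (f : K ⟶ L) {i j k : ι} (hi : c.prev j = i) (hk : c.next j = k)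
    [QuasiIsoAt f j] (x : K.X j) (hx : (K.d j k).hom x = 0) (y : L.X i)
    (hy : (L.d i j).hom y = (f.f j).hom x) : ∃ z : K.X i, (K.d i j).hom z = x := by
  obtain ⟨z', rfl⟩ := exists_iCycles_eq K hk x hx
  rw [← homologyπ_eq_zero_iff K hi]
  have hinj : Function.Injective (HomologicalComplex.homologyMap f j).hom :=
    (ModuleCat.mono_iff_injective _).1 inferInstance
  apply hinj
  rw [map_zero, homologyMap_homologyπ, homologyπ_eq_zero_iff L hi]
  exact ⟨y, by rw [hy, iCycles_cyclesMap]⟩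

lemma exists_of_quasiIsoAt (f : K ⟶ L) {i j k : ι} (hi : c.prev j = i) (hk : c.next j = k)
    [QuasiIsoAt f j] (y : L.X j) (hy : (L.d j k).hom y = 0) :
    ∃ (x : K.X j) (z : L.X i), (K.d j k).hom x = 0 ∧ (f.f j).hom x + (L.d i j).hom z = y := by
  obtain ⟨z', rfl⟩ := exists_iCycles_eq L hk y hy
  have hsurj : Function.Surjective (HomologicalComplex.homologyMap f j).hom :=
    (ModuleCat.epi_iff_surjective _).1 inferInstance
  obtain ⟨h, hh⟩ := hsurj ((L.homologyπ j).hom z')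
  obtain ⟨x, rfl⟩ := homologyπ_surjective K j h
  rw [homologyMap_homologyπ, ← sub_eq_zero, ← map_sub, homologyπ_eq_zero_iff L hi] at hh
  obtain ⟨y, hy'⟩ := hh
  refine ⟨(K.iCycles j).hom x, -y, d_iCycles K j k x, ?_⟩
  rw [map_neg, hy', map_sub, iCycles_cyclesMap]
  abel

/-- If the components of a complex are torsion, so is its homology. -/
lemma isTorsionWrt_homology {I : Ideal A} (K : HomologicalComplex (ModuleCat.{u} A) c) (j : ι)
    (h : IsTorsionWrt I (K.X j)) : IsTorsionWrt I (K.homology j) :=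
  (h.of_injective _ (iCycles_injective K j)).of_surjective _ (homologyπ_surjective K j)

end Elements

lemma exists_directSum_apply_eq {J : Type*} {M N : J → Type*} [∀ j, AddCommGroup (M j)]
    [∀ j, AddCommGroup (N j)] (y : DirectSum J M) (P : ∀ j, M j → N j → Prop)
    (h0 : ∀ j, P j 0 0) (h : ∀ j, ∃ x, P j (y j) x) :
    ∃ x : DirectSum J N, ∀ j, P j (y j) (x j) := by
  classical
  choose g hg using h
  refine ⟨DFinsupp.mk y.support fun j => g j, fun j => ?_⟩
  by_cases hj : j ∈ y.support
  · simpa [hj] using hg j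
  · have hy : y j = 0 := by simpa using hj
    simpa [hj, hy] using h0 j

section DirectSum

variable {A : Type u} [CommRing A] {J : Type u} [DecidableEq J]
  (C D : J → CochainComplex (ModuleCat.{u} A) ℤ) {K : CochainComplex (ModuleCat.{u} A) ℤ}

open HomologicalComplex

/-- The direct sum of a family of cochain complexes of modules. -/
noncomputable def dsum : CochainComplex (ModuleCat.{u} A) ℤ where
  X n := ModuleCat.of A (DirectSum J fun j => (C j).X n)
  d n m := ModuleCat.ofHom (DirectSum.lmap fun j => ((C j).d n m).hom)
  shape n m h := by
    ext : 1
    refine DirectSum.linearMap_ext _ fun j => LinearMap.ext fun x => ?_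
    simp [(C j).shape n m h]
  d_comp_d' n m l _ _ := by
    ext : 1
    refine DirectSum.linearMap_ext _ fun j => LinearMap.ext fun x => ?_
    have : ((C j).d m l).hom (((C j).d n m).hom x) = 0 := congr($((C j).d_comp_d n m l).hom x)
    simp [this]

variable {C D}

/-- The inclusion of a summand. -/
noncomputable def dsumι (j : J) : C j ⟶ dsum C where
  f n := ModuleCat.ofHom (DirectSum.lof A J (fun j => (C j).X n) j)
  comm' n m _ := by
    ext x
    exact DirectSum.lmap_lof (fun j => ((C j).d n m).hom) j x

/-- The universal property of the direct sum. -/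
noncomputable def dsumDesc (φ : ∀ j, C j ⟶ K) : dsum C ⟶ K where
  f n := ModuleCat.ofHom (DirectSum.toModule A J _ fun j => ((φ j).f n).hom)
  comm' n m _ := by
    ext : 1
    refine DirectSum.linearMap_ext _ fun j => LinearMap.ext fun x => ?_
    simp [dsum, f_d_apply (φ j)]

lemma dsumι_dsumDesc (φ : ∀ j, C j ⟶ K) (j : J) : dsumι j ≫ dsumDesc φ = φ j := by
  ext n x
  exact DirectSum.toModule_lof A (φ := fun j => ((φ j).f n).hom) j x

lemma dsum_hom_ext {φ ψ : dsum C ⟶ K} (h : ∀ j, dsumι j ≫ φ = dsumι j ≫ ψ) : φ = ψ := by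
  ext n : 2
  refine DirectSum.linearMap_ext _ fun j => LinearMap.ext fun x => ?_
  exact f_apply_congr (h j) n x

/-- Functoriality of the direct sum. -/
noncomputable def dsumMap (s : ∀ j, C j ⟶ D j) : dsum C ⟶ dsum D :=
  dsumDesc fun j => s j ≫ dsumι j

lemma dsumι_dsumMap (s : ∀ j, C j ⟶ D j) (j : J) : dsumι j ≫ dsumMap s = s j ≫ dsumι j :=
  dsumι_dsumDesc _ j

/-- The projection to a summand. -/
noncomputable def dsumπ (j : J) : dsum C ⟶ C j where
  f n := ModuleCat.ofHom (DirectSum.component A J (fun j => (C j).X n) j)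
  comm' n m _ := by
    ext x
    exact (DirectSum.lmap_apply (fun j => ((C j).d n m).hom) x j).symm

lemma dsum_d_apply (n m : ℤ) (x : DirectSum J fun j => (C j).X n) (j : J) :
    (show DirectSum J fun j => (C j).X m from ((dsum C).d n m).hom x) j =
      ((C j).d n m).hom (x j) :=
  DirectSum.lmap_apply (fun j => ((C j).d n m).hom) x j

lemma dsumMap_f_apply (s : ∀ j, C j ⟶ D j) (n : ℤ) (x : DirectSum J fun j => (C j).X n) (j : J) :
    (show DirectSum J fun j => (D j).X n from ((dsumMap s).f n).hom x) j =
      ((s j).f n).hom (x j) := by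
  have : ((dsumMap s).f n).hom = DirectSum.lmap fun j => ((s j).f n).hom := by
    refine DirectSum.linearMap_ext _ fun j => LinearMap.ext fun x => ?_
    exact (f_apply_congr (dsumι_dsumMap s j) n x).trans
      (DirectSum.lmap_lof (fun j => ((s j).f n).hom) j x).symm
  rw [this]
  exact DirectSum.lmap_apply (fun j => ((s j).f n).hom) x j

instance dsumMap_quasiIso (s : ∀ j, C j ⟶ D j) [∀ j, QuasiIso (s j)] : QuasiIso (dsumMap s) where
  quasiIsoAt n := by
    have hp : (ComplexShape.up ℤ).prev n = n - 1 := by simp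
    have hn : (ComplexShape.up ℤ).next n = n + 1 := by simp
    refine quasiIsoAt_of_elements _ hp hn ?_ ?_
    · intro (x : DirectSum J fun j => (C j).X n) hx
        (y : DirectSum J fun j => (D j).X (n - 1)) hy
      obtain ⟨z, hz⟩ := exists_directSum_apply_eq (N := fun j => (C j).X (n - 1)) x
        (fun j a b => ((C j).d (n - 1) n).hom b = a) (fun j => map_zero _) (fun j => by
          refine exists_of_quasiIsoAt_of_d_eq (s j) hp hn (x j) ?_ (y j) ?_
          · exact (dsum_d_apply _ _ x j).symm.trans
              (congrArg ((dsumπ (C := C) j).f (n + 1)).hom hx)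
          · exact (dsum_d_apply _ _ y j).symm.trans
              ((congrArg ((dsumπ (C := D) j).f n).hom hy).trans (dsumMap_f_apply s n x j)))
      refine ⟨z, DFinsupp.ext fun j => ?_⟩
      exact (dsum_d_apply _ _ z j).trans (hz j)
    · intro (y : DirectSum J fun j => (D j).X n) hy
      obtain ⟨x, hx⟩ := exists_directSum_apply_eq (N := fun j => (C j).X n × (D j).X (n - 1)) y
        (fun j a b => ((C j).d n (n + 1)).hom b.1 = 0 ∧
          ((s j).f n).hom b.1 + ((D j).d (n - 1) n).hom b.2 = a) (fun j => by simp) (fun j => by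
          obtain ⟨x, z, h⟩ := exists_of_quasiIsoAt (s j) hp hn (y j)
            ((dsum_d_apply _ _ y j).symm.trans (congrArg ((dsumπ (C := D) j).f (n + 1)).hom hy))
          exact ⟨(x, z), h⟩)
      let x1 : DirectSum J fun j => (C j).X n := DFinsupp.mapRange (fun j a => a.1) (fun j => rfl) x
      let x2 : DirectSum J fun j => (D j).X (n - 1) :=
        DFinsupp.mapRange (fun j a => a.2) (fun j => rfl) x
      refine ⟨x1, x2, DFinsupp.ext fun j => ?_, DFinsupp.ext fun j => ?_⟩
      · exact (dsum_d_apply _ _ x1 j).trans (hx j).1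
      · refine Eq.trans ?_ (hx j).2
        exact congrArg₂ (· + ·) (dsumMap_f_apply s n x1 j) (dsum_d_apply _ _ x2 j)

lemma dsumι_dsumπ_self (j : J) : dsumι (C := C) j ≫ dsumπ j = 𝟙 (C j) := by
  ext n x
  exact DirectSum.lof_apply A (M := fun j => (C j).X n) j x

lemma dsumι_dsumπ_of_ne {i j : J} (h : i ≠ j) : dsumι (C := C) i ≫ dsumπ j = 0 := by
  ext n x
  exact (DirectSum.component.of A (M := fun j => (C j).X n) j i x).trans (dif_neg h)

/-- A pointwise finite family of morphisms to a family of complexes induces a morphism to their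
direct sum. -/
lemma exists_lift_dsum (φ : ∀ j, K ⟶ C j)
    (hφ : ∀ n (x : K.X n), {j | ((φ j).f n).hom x ≠ 0}.Finite) :
    ∃ f : K ⟶ dsum C, ∀ j, f ≫ dsumπ j = φ j := by
  have key (n : ℤ) : ∃ g : K.X n →ₗ[A] DirectSum J fun j => (C j).X n,
      ∀ x j, g x j = ((φ j).f n).hom x := by
    have hx (x : K.X n) : ∃ y : DirectSum J fun j => (C j).X n, ∀ j, y j = ((φ j).f n).hom x := by
      refine ⟨DFinsupp.mk (hφ n x).toFinset fun j => ((φ j).f n).hom x, fun j => ?_⟩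
      by_cases hj : ((φ j).f n).hom x = 0 <;> simp [DFinsupp.mk_apply, hj]
    choose g hg using hx
    exact ⟨{ toFun := g
             map_add' := fun x y => DFinsupp.ext fun j => by
               rw [DirectSum.add_apply, hg, hg, hg, map_add]
             map_smul' := fun a x => DFinsupp.ext fun j => by
               refine (hg _ _).trans ?_
               rw [map_smul, ← hg]
               rfl }, hg⟩
  choose g hg using key
  refine ⟨{ f := fun n => ModuleCat.ofHom (g n), comm' := fun n m _ => ?_ }, fun j => ?_⟩
  · ext x
    refine DFinsupp.ext fun j => ?_
    refine (dsum_d_apply n m (g n x) j).trans ?_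
    rw [hg]
    exact (f_d_apply (φ j) n m x).trans (hg m _ j).symm
  · ext n x
    exact hg n x j

end DirectSum

section Homotopy

variable {A : Type u} [CommRing A] {J : Type u} [DecidableEq J]
  {C : J → CochainComplex (ModuleCat.{u} A) ℤ} {K : CochainComplex (ModuleCat.{u} A) ℤ}

lemma dsum_X_hom_ext {n : ℤ} {N : ModuleCat.{u} A} {f g : (dsum C).X n ⟶ N}
    (h : ∀ j, (dsumι j).f n ≫ f = (dsumι j).f n ≫ g) : f = g := by
  ext : 1
  exact DirectSum.linearMap_ext _ fun j => congrArg ModuleCat.Hom.hom (h j)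

/-- The universal property of a term of the direct sum. -/
noncomputable def dsumXDesc {n : ℤ} {N : ModuleCat.{u} A} (g : ∀ j, (C j).X n ⟶ N) :
    (dsum C).X n ⟶ N :=
  ModuleCat.ofHom (DirectSum.toModule A J _ fun j => (g j).hom)

lemma dsumι_dsumXDesc {n : ℤ} {N : ModuleCat.{u} A} (g : ∀ j, (C j).X n ⟶ N) (j : J) :
    (dsumι j).f n ≫ dsumXDesc g = g j := by
  ext x
  exact DirectSum.toModule_lof A (φ := fun j => (g j).hom) j x

/-- A morphism from a direct sum of complexes is null-homotopic if its restriction to each summand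
is. -/
noncomputable def dsumHomotopyZero (φ : dsum C ⟶ K) (h : ∀ j, Homotopy (dsumι j ≫ φ) 0) :
    Homotopy φ 0 where
  hom n m := dsumXDesc fun j => (h j).hom n m
  zero n m hnm := dsum_X_hom_ext fun j => by
    rw [dsumι_dsumXDesc, comp_zero, (h j).zero n m hnm]
  comm n := dsum_X_hom_ext fun j => by
    have hn : (ComplexShape.up ℤ).Rel n (n + 1) := rfl
    have hp : (ComplexShape.up ℤ).Rel (n - 1) n := by simp
    have := (h j).comm n
    rw [dNext_eq _ hn, prevD_eq _ hp] at this ⊢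
    rw [HomologicalComplex.comp_f] at this
    rw [this]
    simp only [Preadditive.comp_add, HomologicalComplex.zero_f, comp_zero]
    rw [← Category.assoc, ← Category.assoc, dsumι_dsumXDesc, (dsumι j).comm, Category.assoc,
      dsumι_dsumXDesc]

end Homotopy

section Derived

open DerivedCategory

variable {A : Type u} [CommRing A] [HasDerivedCategory.{w} (ModuleCat.{u} A)]
  {J : Type u} [DecidableEq J]
  {C : J → CochainComplex (ModuleCat.{u} A) ℤ} {K L : CochainComplex (ModuleCat.{u} A) ℤ}

lemma exists_homotopy_of_Q_map_eq_zero (f : K ⟶ L) (hf : Q.map f = 0) :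
    ∃ (X : CochainComplex (ModuleCat.{u} A) ℤ) (s : X ⟶ K), QuasiIso s ∧
      Nonempty (Homotopy (s ≫ f) 0) := by
  have h : Qh.map ((HomotopyCategory.quotient _ _).map f) = Qh.map 0 := by
    rw [← cancel_mono ((quotientCompQhIso _).hom.app L), quotientCompQhIso_hom_naturality, hf]
    simp
  rw [MorphismProperty.map_eq_iff_precomp Qh (HomotopyCategory.quasiIso _ _)] at h
  obtain ⟨X, s, hs, e⟩ := h
  obtain ⟨X, rfl⟩ := HomotopyCategory.quotient_obj_surjective X
  obtain ⟨s, rfl⟩ := (HomotopyCategory.quotient _ _).map_surjective s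
  refine ⟨X, s, ?_, ?_⟩
  · exact (HomotopyCategory.quotient_map_mem_quasiIso_iff _).1 hs
  · rw [← HomotopyCategory.quotient_map_eq_zero_iff]
    simpa using e

lemma Q_map_eq_zero_of_homotopy (f : K ⟶ L) (h : Homotopy f 0) :
    (Q.map f : Q.obj K ⟶ Q.obj L) = 0 := by
  rw [← cancel_epi ((quotientCompQhIso _).hom.app K), ← quotientCompQhIso_hom_naturality,
    (HomotopyCategory.quotient_map_eq_zero_iff f).2 ⟨h⟩]
  simp

lemma dsum_Q_hom_ext {Z : DerivedCategory (ModuleCat.{u} A)} {f g : Q.obj (dsum C) ⟶ Z}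
    (h : ∀ j, Q.map (dsumι j) ≫ f = Q.map (dsumι j) ≫ g) : f = g := by
  suffices H : ∀ (W : CochainComplex (ModuleCat.{u} A) ℤ) (f : Q.obj (dsum C) ⟶ Q.obj W),
      (∀ j, Q.map (dsumι j) ≫ f = 0) → f = 0 by
    rw [← sub_eq_zero, ← cancel_mono (Q.objObjPreimageIso Z).inv, zero_comp]
    refine H _ _ fun j => ?_
    rw [← Category.assoc, Preadditive.comp_sub, h, sub_self, zero_comp]
  intro W f hf
  obtain ⟨Y, φ, s, _, rfl⟩ := left_fac f
  have hφ (j) : Q.map (dsumι (C := C) j ≫ φ) = 0 := by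
    rw [← cancel_mono (inv (Q.map s)), Q.map_comp, Category.assoc, hf, zero_comp]
  choose X t ht hh using fun j => exists_homotopy_of_Q_map_eq_zero _ (hφ j)
  have h0 : Q.map (dsumMap t ≫ φ) = 0 := by
    refine Q_map_eq_zero_of_homotopy _ (dsumHomotopyZero _ fun j => ?_)
    refine Homotopy.trans (Homotopy.ofEq ?_) (hh j).some
    rw [← Category.assoc, dsumι_dsumMap, Category.assoc]
  rw [Q.map_comp] at h0
  rw [← cancel_epi (Q.map (dsumMap t)), ← Category.assoc, h0]
  simp

lemma exists_dsum_Q_desc {Z : DerivedCategory (ModuleCat.{u} A)} (g : ∀ j, Q.obj (C j) ⟶ Z) :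
    ∃ f : Q.obj (dsum C) ⟶ Z, ∀ j, Q.map (dsumι j) ≫ f = g j := by
  choose X s hs φ hφ using fun j => right_fac (g j ≫ (Q.objObjPreimageIso Z).inv)
  have h (j : J) : QuasiIso (s j) := by
    rw [← DerivedCategory.isIso_Q_map_iff_quasiIso]
    exact hs j
  refine ⟨inv (Q.map (dsumMap s)) ≫ Q.map (dsumDesc φ) ≫ (Q.objObjPreimageIso Z).hom, fun j => ?_⟩
  rw [← cancel_mono (Q.objObjPreimageIso Z).inv, hφ, ← cancel_epi (Q.map (s j)),
    IsIso.hom_inv_id_assoc, ← Category.assoc, ← Category.assoc, ← Q.map_comp, ← dsumι_dsumMap,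
    Q.map_comp]
  simp only [Category.assoc, IsIso.hom_inv_id_assoc, Iso.hom_inv_id, Category.comp_id]
  rw [← Q.map_comp, dsumι_dsumDesc]

end Derived

section Comparison

variable {T : Type u} [Category.{w} T] [Preadditive T] (E : T) {J : Type u} [DecidableEq J]
  (Y : J → T) [HasCoproduct Y]

lemma coproductComparison_of (j : J) (f : E ⟶ Y j) :
    coproductComparison E Y (DirectSum.of (fun j => E ⟶ Y j) j f) = f ≫ Sigma.ι Y j := by
  simp [coproductComparison]

lemma coproductComparison_comp_π (d : DirectSum J fun j => E ⟶ Y j) (j : J) :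
    coproductComparison E Y d ≫ Sigma.π Y j = d j := by
  induction d using DirectSum.induction_on with
  | zero => simp
  | of i f =>
    rw [coproductComparison_of, Category.assoc]
    obtain rfl | h := eq_or_ne i j
    · simp
    · rw [Sigma.ι_π_of_ne _ h, comp_zero, DirectSum.of_eq_of_ne _ _ _ h.symm]
  | add x y hx hy => simp [Preadditive.add_comp, hx, hy]

lemma coproductComparison_injective : Function.Injective (coproductComparison E Y) := by
  intro d d' h
  refine DFinsupp.ext fun j => ?_
  rw [← coproductComparison_comp_π, ← coproductComparison_comp_π, h]

variable {E Y} in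
/-- A morphism from a compact object to a coproduct has only finitely many nonzero components. -/
lemma IsCompactObjIn.finite_π {S : Set T} (hE : IsCompactObjIn S E) (hY : ∀ j, Y j ∈ S)
    (f : E ⟶ ∐ Y) : {j | f ≫ Sigma.π Y j ≠ 0}.Finite := by
  classical
  obtain ⟨d, rfl⟩ := (hE J Y hY).2 f
  simp only [coproductComparison_comp_π]
  exact (DFinsupp.support d).finite_toSet.subset fun j hj => by simpa using hj

end Comparison

section Derived

open DerivedCategory

variable {A : Type u} [CommRing A] [HasDerivedCategory.{w} (ModuleCat.{u} A)]
  {K L : CochainComplex (ModuleCat.{u} A) ℤ}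

lemma exists_Q_map_eq_of_isKProjective [K.IsKProjective] (f : Q.obj K ⟶ Q.obj L) :
    ∃ φ : K ⟶ L, Q.map φ = f := by
  obtain ⟨g, hg⟩ := (CochainComplex.IsKProjective.Qh_map_bijective K _).surjective
    ((quotientCompQhIso _).hom.app K ≫ f ≫ (quotientCompQhIso _).inv.app L)
  obtain ⟨φ, rfl⟩ := (HomotopyCategory.quotient _ _).map_surjective g
  refine ⟨φ, ?_⟩
  rw [← cancel_epi ((quotientCompQhIso _).hom.app K), ← quotientCompQhIso_hom_naturality, hg]
  simp

lemma nonempty_homotopy_zero_of_Q_map_eq_zero [K.IsKProjective] (φ : K ⟶ L)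
    (h : Q.map φ = 0) : Nonempty (Homotopy φ 0) := by
  rw [← HomotopyCategory.quotient_map_eq_zero_iff]
  apply (CochainComplex.IsKProjective.Qh_map_bijective K _).injective
  rw [← cancel_mono ((quotientCompQhIso _).hom.app L), quotientCompQhIso_hom_naturality, h]
  simp

/-- The direct sum of a family of complexes is a coproduct in the derived category. -/
lemma exists_isColimit_dsum {J : Type u} [DecidableEq J] {J' : Type*} (e : J' ≃ J)
    (C : J → CochainComplex (ModuleCat.{u} A) ℤ) :
    Nonempty (IsColimit (Cofan.mk (Q.obj (dsum C))
      fun j : J' => Q.map (dsumι (C := C) (e j)))) := by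
  have key (s : Cofan fun j' : J' => Q.obj (C (e j'))) :
      ∃ f : Q.obj (dsum C) ⟶ s.pt, ∀ j, Q.map (dsumι (C := C) (e j)) ≫ f = s.inj j := by
    obtain ⟨f, hf⟩ := exists_dsum_Q_desc (C := C)
      (Equiv.piCongrLeft (fun j => Q.obj (C j) ⟶ s.pt) e s.inj)
    exact ⟨f, fun j => (hf _).trans
      (Equiv.piCongrLeft_apply_apply (fun j => Q.obj (C j) ⟶ s.pt) e s.inj j)⟩
  choose f hf using key
  refine ⟨Cofan.IsColimit.mk _ f hf fun s m hm => dsum_Q_hom_ext fun j => ?_⟩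
  obtain ⟨j, rfl⟩ := e.surjective j
  exact (hm j).trans (hf s j).symm

/-- A pointwise finite family of morphisms from a complex which is compact in `DTor I` has only
finitely many members which do not vanish in the derived category. -/
lemma finite_setOf_Q_map_ne_zero {I : Ideal A} (hK : IsCompactObjIn (DTor I) (Q.obj K))
    {J : Type} (C : J → CochainComplex (ModuleCat.{u} A) ℤ) (hC : ∀ j, Q.obj (C j) ∈ DTor I)
    (φ : ∀ j, K ⟶ C j) (hφ : ∀ n (x : K.X n), {j | ((φ j).f n).hom x ≠ 0}.Finite) :
    {j | Q.map (φ j) ≠ 0}.Finite := by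
  classical
  let C' : ULift.{u} J → CochainComplex (ModuleCat.{u} A) ℤ := fun j => C j.down
  let e : ULift.{u + 1} J ≃ ULift.{u} J := Equiv.ulift.trans Equiv.ulift.symm
  let Y : ULift.{u + 1} J → DerivedCategory (ModuleCat.{u} A) := fun j => Q.obj (C j.down)
  obtain ⟨hc⟩ := exists_isColimit_dsum e C'
  have : HasCoproduct Y := ⟨⟨_, hc⟩⟩
  obtain ⟨f, hf⟩ := exists_lift_dsum (C := C') (fun j => φ j.down) fun n x =>
    (hφ n x).preimage (ULift.down_injective.injOn)
  let i : Q.obj (dsum C') ⟶ ∐ Y := hc.desc (Cofan.mk _ (Sigma.ι Y))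
  have hi (j : J) : i ≫ Sigma.π Y ⟨j⟩ = Q.map (dsumπ (C := C') ⟨j⟩) := by
    refine dsum_Q_hom_ext fun k => ?_
    have h : Q.map (dsumι k) ≫ i = Sigma.ι Y ⟨k.down⟩ := hc.fac (Cofan.mk _ (Sigma.ι Y)) ⟨⟨k.down⟩⟩
    rw [← Category.assoc, h, ← Q.map_comp]
    by_cases hk : k = ⟨j⟩
    · subst hk
      rw [dsumι_dsumπ_self, Q.map_id, Sigma.ι_π_eq_id]
    · rw [dsumι_dsumπ_of_ne hk, Q.map_zero, Sigma.ι_π_of_ne]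
      intro h
      exact hk (ULift.ext _ _ congr(($h).down))
  have := hK.finite_π (Y := Y) (fun j => hC j.down) (Q.map f ≫ i)
  refine (this.preimage (f := ULift.up) ULift.up_injective.injOn).subset fun j hj => ?_
  rw [Set.mem_preimage, Set.mem_ofPred_eq, Category.assoc, hi, ← Q.map_comp, hf]
  exact hj

end Derived

section CompactOfPerfect

open DerivedCategory

variable {A : Type u} [CommRing A]

/-- A morphism from a bounded complex of finitely generated modules to a direct sum of complexes
has only finitely many nonzero components. -/
lemma IsBoundedComplexOfFinProj.finite_dsumπ {K : CochainComplex (ModuleCat.{u} A) ℤ}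
    (hK : IsBoundedComplexOfFinProj K) {J : Type u} [DecidableEq J]
    {C : J → CochainComplex (ModuleCat.{u} A) ℤ} (ψ : K ⟶ dsum C) :
    {j | ψ ≫ dsumπ j ≠ 0}.Finite := by
  classical
  obtain ⟨hK, a, b, hab⟩ := hK
  have h1 (n : ℤ) : {j | (ψ ≫ dsumπ j).f n ≠ 0}.Finite := by
    obtain ⟨s, hs⟩ := (hK n).1.fg_top
    refine (Set.Finite.biUnion s.finite_toSet fun x _ =>
      (DFinsupp.support (show DirectSum J fun j => (C j).X n from
        (ψ.f n).hom x)).finite_toSet).subset fun j hj => ?_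
    by_contra hj'
    apply hj
    ext : 1
    refine LinearMap.ext_on_range (v := ((↑) : s → K.X n)) (by simpa using hs) fun x => ?_
    simp only [Set.mem_iUnion, not_exists] at hj'
    have := hj' x.1 x.2
    exact DFinsupp.notMem_support_iff.1 this
  refine (Set.Finite.biUnion (Set.finite_Icc a b) fun n _ => h1 n).subset fun j hj => ?_
  by_contra hj'
  apply hj
  ext n : 1
  by_cases hn : n < a ∨ b < n
  · exact (hab n hn).eq_of_src _ _
  · simp only [Set.mem_iUnion, not_exists] at hj'
    have := hj' n ⟨by omega, by omega⟩
    simpa using this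

lemma eq_sum_dsumπ_dsumι {K : CochainComplex (ModuleCat.{u} A) ℤ} {J : Type u} [DecidableEq J]
    {C : J → CochainComplex (ModuleCat.{u} A) ℤ} (ψ : K ⟶ dsum C)
    (h : {j | ψ ≫ dsumπ j ≠ 0}.Finite) :
    ψ = ∑ j ∈ h.toFinset, (ψ ≫ dsumπ j) ≫ dsumι j := by
  have hext {φ φ' : K ⟶ dsum C} (h : ∀ j, φ ≫ dsumπ j = φ' ≫ dsumπ j) : φ = φ' := by
    ext n x
    exact DFinsupp.ext fun j => f_apply_congr (h j) n x
  refine hext fun k => ?_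
  simp only [Preadditive.sum_comp, Category.assoc]
  rw [Finset.sum_eq_single k]
  · rw [dsumι_dsumπ_self, Category.comp_id]
  · intro j _ hj
    rw [dsumι_dsumπ_of_ne hj, comp_zero, comp_zero]
  · intro hk
    have hk : ψ ≫ dsumπ k = 0 := by simpa using hk
    rw [← Category.assoc, hk, zero_comp]

lemma IsBoundedComplexOfFinProj.isKProjective {K : CochainComplex (ModuleCat.{u} A) ℤ}
    (hK : IsBoundedComplexOfFinProj K) : K.IsKProjective := by
  obtain ⟨hK, a, b, hab⟩ := hK
  have : K.IsStrictlyLE b := by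
    rw [CochainComplex.isStrictlyLE_iff]
    exact fun i hi => hab i (Or.inr hi)
  have (n : ℤ) : Projective (K.X n) :=
    have := (hK n).2
    (IsProjective.iff_projective (R := A) (K.X n)).1 this
  exact CochainComplex.isKProjective_of_projective K b

variable [HasDerivedCategory.{w} (ModuleCat.{u} A)]

lemma isZero_of_homology (Y : DerivedCategory (ModuleCat.{u} A))
    (h : ∀ n, Subsingleton ((homologyFunctor (ModuleCat.{u} A) n).obj Y)) : IsZero Y := by
  have : IsIso (0 : Y ⟶ Y) := by
    rw [DerivedCategory.isIso_iff]
    intro n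
    have := ModuleCat.isZero_of_subsingleton ((homologyFunctor (ModuleCat.{u} A) n).obj Y)
    exact this.isIso this _
  rw [IsZero.iff_id_eq_zero, ← cancel_epi (0 : Y ⟶ Y)]
  simp

/-- Only a small set of summands of a coproduct in the derived category are nonzero. -/
lemma small_setOf_not_isZero {J : Type*} (Y : J → DerivedCategory (ModuleCat.{u} A))
    [HasCoproduct Y] : Small.{u} {j // ¬ IsZero (Y j)} := by
  have h (j : {j // ¬ IsZero (Y j)}) :
      ∃ (n : ℤ) (y : (homologyFunctor (ModuleCat.{u} A) n).obj (Y j)), y ≠ 0 := by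
    by_contra! h
    exact j.2 (isZero_of_homology _ fun n => ⟨fun x y => (h n x).trans (h n y).symm⟩)
  choose n y hy using h
  classical
  refine small_of_injective (β := Σ n : ℤ, (homologyFunctor (ModuleCat.{u} A) n).obj (∐ Y))
    (f := fun j => ⟨n j, ((homologyFunctor _ (n j)).map (Sigma.ι Y j)).hom (y j)⟩) ?_
  intro i j hij
  by_contra hne
  apply hy i
  have key (j' : {j // ¬ IsZero (Y j)}) (m : ℤ)
    (x : (homologyFunctor (ModuleCat.{u} A) m).obj (∐ Y))
    (e : (⟨m, x⟩ : Σ n : ℤ, (homologyFunctor (ModuleCat.{u} A) n).obj (∐ Y)) =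
      ⟨n j', ((homologyFunctor _ (n j')).map (Sigma.ι Y j')).hom (y j')⟩) (hne : j' ≠ i) :
    ((homologyFunctor _ m).map (Sigma.π Y i)).hom x = 0 := by
    cases e
    have : (homologyFunctor _ (n j')).map (Sigma.ι Y j') ≫
      (homologyFunctor _ (n j')).map (Sigma.π Y i) = 0 := by
      rw [← Functor.map_comp, Sigma.ι_π_of_ne _ (fun h => hne (Subtype.ext h)), Functor.map_zero]
    exact congr($(this).hom (y j'))
  have h1 := key j _ _ hij (Ne.symm hne)
  have : (homologyFunctor _ (n i)).map (Sigma.ι Y i) ≫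
      (homologyFunctor _ (n i)).map (Sigma.π Y i) = 𝟙 _ := by
    rw [← Functor.map_comp, Sigma.ι_π_eq_id, CategoryTheory.Functor.map_id]
  exact congr($(this).hom (y i)).symm.trans h1

/-- A bounded complex of finitely generated projective modules is compact. -/
lemma isCompactObjIn_of_isBoundedComplexOfFinProj {K : CochainComplex (ModuleCat.{u} A) ℤ}
    (hK : IsBoundedComplexOfFinProj K) (S : Set (DerivedCategory (ModuleCat.{u} A)))
    {M : DerivedCategory (ModuleCat.{u} A)} (i : M ≅ Q.obj K) : IsCompactObjIn S M := by
  intro J _ Y _ _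
  refine ⟨coproductComparison_injective M Y, fun f => ?_⟩
  classical
  have := small_setOf_not_isZero Y
  let e := equivShrink.{u} {j // ¬ IsZero (Y j)}
  let C : Shrink.{u} {j // ¬ IsZero (Y j)} → CochainComplex (ModuleCat.{u} A) ℤ :=
    fun j => Q.objPreimage (Y (e.symm j))
  let k (j) : Q.obj (C j) ≅ Y (e.symm j) := Q.objObjPreimageIso (Y (e.symm j))
  obtain ⟨g, hg⟩ := exists_dsum_Q_desc (C := C) fun j => (k j).hom ≫ Sigma.ι Y (e.symm j)
  have hh (j : J) : ∃ h : Y j ⟶ Q.obj (dsum C), h ≫ g = Sigma.ι Y j := by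
    by_cases hj : IsZero (Y j)
    · exact ⟨0, hj.eq_of_src _ _⟩
    · obtain ⟨j', hj'⟩ := e.symm.surjective ⟨j, hj⟩
      obtain rfl : e.symm j' = j := congr_arg Subtype.val hj'
      exact ⟨(k j').inv ≫ Q.map (dsumι j'), by rw [Category.assoc, hg, Iso.inv_hom_id_assoc]⟩
  choose h hh using hh
  have hid : Sigma.desc h ≫ g = 𝟙 _ := Sigma.hom_ext _ _ fun j => by simp [hh]
  have := hK.isKProjective
  obtain ⟨ψ, hψ⟩ := exists_Q_map_eq_of_isKProjective (i.inv ≫ f ≫ Sigma.desc h)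
  have hf : f = i.hom ≫ Q.map ψ ≫ g := by
    simp [hψ, hid]
  rw [hf, eq_sum_dsumπ_dsumι ψ (hK.finite_dsumπ ψ), Q.map_sum, Preadditive.sum_comp,
    Preadditive.comp_sum]
  change _ ∈ (coproductComparison M Y).range
  refine sum_mem fun j _ => ?_
  refine ⟨DirectSum.of _ (e.symm j).1 (i.hom ≫ Q.map (ψ ≫ dsumπ j) ≫ (k j).hom), ?_⟩
  rw [coproductComparison_of, Q.map_comp (ψ ≫ dsumπ j)]
  simp only [Category.assoc, hg]

end CompactOfPerfect

section ToSingle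

open DerivedCategory

variable {A : Type u} [CommRing A] {C : CochainComplex (ModuleCat.{u} A) ℤ} {n : ℤ}
  {T : ModuleCat.{u} A}

/-- The morphism to a complex concentrated in one degree given by a morphism vanishing on
boundaries. -/
noncomputable def toSingle (φ : C.X n ⟶ T) (hφ : C.d (n - 1) n ≫ φ = 0) :
    C ⟶ (HomologicalComplex.single (ModuleCat.{u} A) (ComplexShape.up ℤ) n).obj T :=
  HomologicalComplex.mkHomToSingle φ fun i hi => by
    obtain rfl : i = n - 1 := by
      have : i + 1 = n := hi
      omega
    exact hφ

lemma toSingle_f_eq_zero_of_ne (φ : C.X n ⟶ T) (hφ : C.d (n - 1) n ≫ φ = 0) {m : ℤ}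
    (h : m ≠ n) : (toSingle φ hφ).f m = 0 :=
  dif_neg h

lemma toSingle_f_self (φ : C.X n ⟶ T) (hφ : C.d (n - 1) n ≫ φ = 0) :
    (toSingle φ hφ).f n = φ ≫ (HomologicalComplex.singleObjXSelf _ n T).inv :=
  HomologicalComplex.mkHomToSingle_f φ _

lemma toSingle_f_apply_eq_zero_iff (φ : C.X n ⟶ T) (hφ : C.d (n - 1) n ≫ φ = 0) (x : C.X n) :
    ((toSingle φ hφ).f n).hom x = 0 ↔ φ.hom x = 0 := by
  rw [toSingle_f_self]
  have : Function.Injective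
      (HomologicalComplex.singleObjXSelf (ComplexShape.up ℤ) n T).inv.hom :=
    (ModuleCat.mono_iff_injective _).1 inferInstance
  exact map_eq_zero_iff _ this

lemma finite_setOf_toSingle_f_ne_zero {J : Type*} (n : J → ℤ) (hn : Function.Injective n)
    (T : J → ModuleCat.{u} A) (φ : ∀ j, C.X (n j) ⟶ T j) (hφ : ∀ j, C.d (n j - 1) (n j) ≫ φ j = 0)
    (m : ℤ) (x : C.X m) : {j | ((toSingle (φ j) (hφ j)).f m).hom x ≠ 0}.Finite := by
  refine ((Set.finite_singleton m).preimage hn.injOn).subset fun j hj => ?_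
  by_contra hne
  apply hj
  rw [toSingle_f_eq_zero_of_ne _ _ (Ne.symm hne)]
  rfl

lemma homologyι_homologyπ (C : CochainComplex (ModuleCat.{u} A) ℤ) (n : ℤ) (z : C.cycles n) :
    (C.homologyι n).hom ((C.homologyπ n).hom z) = (C.pOpcycles n).hom ((C.iCycles n).hom z) :=
  congr($(C.homology_π_ι n).hom z)

lemma d_pOpcycles_comp (ψ : C.opcycles n ⟶ T) : C.d (n - 1) n ≫ C.pOpcycles n ≫ ψ = 0 := by
  rw [← Category.assoc, C.d_pOpcycles, zero_comp]

variable [HasDerivedCategory.{w} (ModuleCat.{u} A)]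

lemma Q_obj_mem_DTor_iff (I : Ideal A) :
    Q.obj C ∈ DTor I ↔ ∀ n, IsTorsionWrt I (C.homology n) := by
  refine forall_congr' fun n => ?_
  have e := ((homologyFunctorFactors (ModuleCat.{u} A) n).app C).toLinearEquiv
  exact ⟨fun h => h.of_injective e.symm.toLinearMap e.symm.injective,
    fun h => h.of_injective e.toLinearMap e.injective⟩

lemma Q_single_mem_DTor {I : Ideal A} (n : ℤ) (hT : IsTorsionWrt I T) :
    Q.obj ((HomologicalComplex.single (ModuleCat.{u} A) (ComplexShape.up ℤ) n).obj T) ∈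
      DTor I := by
  rw [Q_obj_mem_DTor_iff]
  intro m
  apply isTorsionWrt_homology
  by_cases h : m = n
  · subst h
    let e := (HomologicalComplex.singleObjXSelf (ComplexShape.up ℤ) m T).toLinearEquiv
    exact hT.of_injective e.toLinearMap e.injective
  · have := ModuleCat.subsingleton_of_isZero
      (HomologicalComplex.isZero_single_obj_X (ComplexShape.up ℤ) n T m h)
    exact .of_subsingleton

lemma apply_eq_zero_of_Q_map_toSingle_eq_zero (φ : C.X n ⟶ T) (hφ : C.d (n - 1) n ≫ φ = 0)
    (h : Q.map (toSingle φ hφ) = 0) (x : C.X n) (hx : (C.d n (n + 1)).hom x = 0) :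
    φ.hom x = 0 := by
  have h0 : HomologicalComplex.homologyMap (toSingle φ hφ) n = 0 := by
    refine (cancel_epi ((homologyFunctorFactors _ n).hom.app C)).1 ?_
    have := (homologyFunctorFactors (ModuleCat.{u} A) n).hom.naturality (toSingle φ hφ)
    refine this.symm.trans ?_
    rw [Functor.comp_map, h, Functor.map_zero, zero_comp]
    exact comp_zero.symm
  obtain ⟨z, rfl⟩ := exists_iCycles_eq C (by simp) x hx
  have h1 := homologyMap_homologyπ (toSingle φ hφ) n z
  rw [h0] at h1
  obtain ⟨y, hy⟩ := (homologyπ_eq_zero_iff _ (i := n - 1) (by simp) _).1 h1.symm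
  rw [iCycles_cyclesMap] at hy
  rw [← toSingle_f_apply_eq_zero_iff φ hφ, ← hy]
  rw [HomologicalComplex.single_obj_d]
  rfl

lemma apply_homologyι_eq_zero (ψ : C.opcycles n ⟶ T)
    (h : Q.map (toSingle (C.pOpcycles n ≫ ψ) (d_pOpcycles_comp ψ)) = 0)
    (x : C.homology n) : ψ.hom ((C.homologyι n).hom x) = 0 := by
  obtain ⟨z, rfl⟩ := homologyπ_surjective C n x
  rw [homologyι_homologyπ]
  exact apply_eq_zero_of_Q_map_toSingle_eq_zero _ _ h _ (d_iCycles C _ _ z)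

variable [IsNoetherianRing A] {I : Ideal A}

/-- A compact object of `DTor I` has only finitely many nonzero homology modules. -/
lemma finite_setOf_homology_ne_zero (hC : IsCompactObjIn (DTor I) (Q.obj C))
    (hCI : Q.obj C ∈ DTor I) : {n : ℤ | ¬ Subsingleton (C.homology n)}.Finite := by
  rw [Q_obj_mem_DTor_iff] at hCI
  choose E hE hE' j hj using fun n => exists_injective_torsion_hull (hCI n)
  choose ψ hψ using fun n => (hE' n).exists_extend (Y := C.opcycles n) (C.homologyι n).hom
    (homologyι_injective C n) (j n)
  refine (finite_setOf_Q_map_ne_zero hC _ (fun n => Q_single_mem_DTor n (hE n))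
    (fun n => toSingle _ (d_pOpcycles_comp (ModuleCat.ofHom (ψ n))))
    (finite_setOf_toSingle_f_ne_zero _ Function.injective_id _ _ _)).subset ?_
  intro n hn h
  refine hn ⟨fun x y => hj n ?_⟩
  have key (x) : j n x = 0 := by
    rw [← hψ]
    exact apply_homologyι_eq_zero _ h x
  rw [key, key]

/-- The homology modules of a compact object of `DTor I` are noetherian. -/
lemma isNoetherian_homology (hC : IsCompactObjIn (DTor I) (Q.obj C))
    (hCI : Q.obj C ∈ DTor I) (n : ℤ) : IsNoetherian A (C.homology n) := by
  rw [Q_obj_mem_DTor_iff] at hCI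
  rw [← monotone_stabilizes_iff_noetherian]
  intro N
  choose E hE hE' j hj using fun i => exists_injective_torsion_hull
    ((hCI n).of_surjective (N i).mkQ (Submodule.mkQ_surjective _))
  let S : Submodule A (C.homology n) := ⨆ i, N i
  have hS (x : S) : ∃ i, x.1 ∈ N i :=
    (Submodule.mem_iSup_of_directed _ N.monotone.directed_le).1 x.2
  let f (i : ℕ) : S →ₗ[A] E i := j i ∘ₗ (N i).mkQ ∘ₗ S.subtype
  have hf (i : ℕ) (x : S) : f i x = 0 ↔ x.1 ∈ N i := by
    rw [← Submodule.Quotient.mk_eq_zero, ← map_eq_zero_iff _ (hj i)]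
    rfl
  have hfin (x : S) : {i | f i x ≠ 0}.Finite := by
    obtain ⟨i, hi⟩ := hS x
    refine (Set.finite_lt_nat i).subset fun k hk => ?_
    by_contra hik
    exact hk ((hf k x).2 (N.monotone (not_lt.1 hik) hi))
  classical
  have hg (x : S) : ∃ y : DirectSum ℕ fun i => E i, ∀ i, y i = f i x := by
    refine ⟨DFinsupp.mk (hfin x).toFinset fun i => f i x, fun i => ?_⟩
    by_cases hi : f i x = 0 <;> simp [DFinsupp.mk_apply, hi]
  choose g hg using hg
  let g' : S →ₗ[A] DirectSum ℕ fun i => E i :=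
    { toFun := g
      map_add' := fun x y => DFinsupp.ext fun i => by
        rw [DirectSum.add_apply, hg, hg, hg, map_add]
      map_smul' := fun a x => DFinsupp.ext fun i => by
        refine (hg _ _).trans ?_
        rw [map_smul, ← hg]
        rfl }
  obtain ⟨ψ, hψ⟩ := Module.Baer.exists_extend
    (E := ModuleCat.of A (DirectSum ℕ fun i => E i)) (baer_directSum _ hE')
    (X := ModuleCat.of A S) (Y := C.opcycles n)
    ((C.homologyι n).hom ∘ₗ S.subtype)
    ((homologyι_injective C n).comp Subtype.val_injective) g'
  let ψ' (i : ℕ) : C.opcycles n ⟶ E i :=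
    ModuleCat.ofHom (DirectSum.component A ℕ (fun i => E i) i ∘ₗ ψ)
  have hψ' (i : ℕ) (x : S) : (ψ' i).hom ((C.homologyι n).hom x.1) = f i x :=
    (congrArg (DirectSum.component A ℕ (fun i => E i) i) (LinearMap.congr_fun hψ x)).trans (hg x i)
  obtain ⟨i, hi⟩ := (finite_setOf_Q_map_ne_zero hC _ (fun i => Q_single_mem_DTor n (hE i))
    (fun i => toSingle _ (d_pOpcycles_comp (ψ' i))) fun m x => by
      by_cases hm : m = n
      · subst hm
        refine (DFinsupp.support (show DirectSum ℕ fun i => E i from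
          ψ ((C.pOpcycles m).hom x))).finite_toSet.subset fun i hi => ?_
        rw [Set.mem_ofPred_eq, ne_eq, toSingle_f_apply_eq_zero_iff] at hi
        exact DFinsupp.mem_support_iff.2 hi
      · refine Set.finite_empty.subset fun i hi => hi ?_
        rw [toSingle_f_eq_zero_of_ne _ _ hm]
        rfl).exists_notMem
  rw [Set.mem_ofPred_eq, not_not] at hi
  have hSi : S ≤ N i := fun x hx => by
    rw [← hf i ⟨x, hx⟩, ← hψ']
    exact apply_homologyι_eq_zero _ hi x
  exact ⟨i, fun m hm => le_antisymm (N.monotone hm) ((le_iSup N m).trans hSi)⟩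

end ToSingle

section Resolution

variable {A : Type u} [CommRing A] (D : ChainComplex (ModuleCat.{u} A) ℕ)

/-- The top part of a partially constructed resolution of `D` by finitely generated projective
modules, in degree `i`: a module `F` mapping to `D.X i` and the submodule `Z` of cycles. -/
structure ResolutionStage (i : ℕ) where
  /-- the component of the resolution -/
  F : ModuleCat.{u} A
  finite : Module.Finite A F
  projective : Module.Projective A F
  /-- the map to `D` -/
  φ : F ⟶ D.X i
  /-- the cycles -/
  Z : Submodule A F
  d_φ : ∀ z ∈ Z, (D.d i ((ComplexShape.down ℕ).next i)).hom (φ.hom z) = 0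
  exists_of_d_eq_zero : ∀ c : D.X i, (D.d i ((ComplexShape.down ℕ).next i)).hom c = 0 →
    ∃ z ∈ Z, ∃ e : D.X (i + 1), φ.hom z + (D.d (i + 1) i).hom e = c

/-- The compatibility between two consecutive stages of a resolution. -/
structure ResolutionStep {i : ℕ} (s : ResolutionStage D i) (t : ResolutionStage D (i + 1)) where
  /-- the differential -/
  d : t.F ⟶ s.F
  d_mem : ∀ x, d.hom x ∈ s.Z
  mem_iff : ∀ x, x ∈ t.Z ↔ d.hom x = 0
  comm : d ≫ s.φ = t.φ ≫ D.d (i + 1) i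
  exists_d_eq : ∀ z ∈ s.Z, ∀ c, s.φ.hom z = (D.d (i + 1) i).hom c → ∃ x, d.hom x = z

/-- A finitely generated homology module is covered by a finite free module mapping to cycles. -/
lemma exists_finite_free_cover (i : ℕ) [Module.Finite A (D.homology i)] :
    ∃ (k : ℕ) (g : ModuleCat.of A (ULift.{u} (Fin k) → A) ⟶ D.cycles i),
      Function.Surjective (g ≫ D.homologyπ i).hom := by
  obtain ⟨k, p, hp⟩ := Module.Finite.exists_fin' A (D.homology i)
  let q := p ∘ₗ (LinearEquiv.funCongrLeft A A (Equiv.ulift.{u} (α := Fin k)).symm).toLinearMap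
  have hq : Function.Surjective q := hp.comp (LinearEquiv.surjective _)
  obtain ⟨g, hg⟩ := Module.projective_lifting_property (D.homologyπ i).hom q
    (homologyπ_surjective D i)
  refine ⟨k, ModuleCat.ofHom g, ?_⟩
  intro y
  obtain ⟨x, hx⟩ := hq y
  exact ⟨x, congr($hg x).trans hx⟩

/-- The initial stage of a resolution. -/
lemma exists_resolutionStage_zero [Module.Finite A (D.homology 0)] :
    ∃ s : ResolutionStage D 0, s.Z = ⊤ := by
  obtain ⟨k, g, hg⟩ := exists_finite_free_cover D 0
  have h0 : D.d 0 ((ComplexShape.down ℕ).next 0) = 0 := D.shape _ _ (by simp)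
  refine ⟨{ F := ModuleCat.of A (ULift.{u} (Fin k) → A)
            finite := ?_, projective := ?_, φ := g ≫ D.iCycles 0, Z := ⊤, d_φ := ?_
            exists_of_d_eq_zero := ?_ }, rfl⟩
  · change Module.Finite A (ULift.{u} (Fin k) → A)
    infer_instance
  · change Module.Projective A (ULift.{u} (Fin k) → A)
    infer_instance
  · intro z _
    rw [h0]
    rfl
  · intro c hc
    obtain ⟨z, rfl⟩ := exists_iCycles_eq D rfl c hc
    obtain ⟨x, hx⟩ := hg (D.homologyπ 0 z)
    have h1 : (D.homologyπ 0).hom (z - g.hom x) = 0 := by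
      rw [map_sub, sub_eq_zero]
      exact hx.symm
    rw [homologyπ_eq_zero_iff D (i := 1) (by simp)] at h1
    obtain ⟨e, he⟩ := h1
    refine ⟨x, trivial, e, ?_⟩
    change _ + (D.d 1 0).hom e = _
    rw [he, map_sub]
    exact add_sub_cancel _ _

/-- The inductive step in the construction of a resolution. -/
lemma exists_resolutionStep [IsNoetherianRing A] (i : ℕ) [Module.Finite A (D.homology (i + 1))]
    (s : ResolutionStage D i) :
    ∃ t : ResolutionStage D (i + 1), Nonempty (ResolutionStep D s t) := by
  obtain ⟨k, g, hg⟩ := exists_finite_free_cover D (i + 1)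
  have := s.finite
  let W : Submodule A (s.F × D.X (i + 1)) :=
    (s.Z.comap (LinearMap.fst A _ _)) ⊓
      LinearMap.ker (s.φ.hom ∘ₗ LinearMap.fst A _ _ - (D.d (i + 1) i).hom ∘ₗ LinearMap.snd A _ _)
  have hW (w : s.F × D.X (i + 1)) : w ∈ W ↔ w.1 ∈ s.Z ∧ s.φ.hom w.1 = (D.d (i + 1) i).hom w.2 := by
    simp [W, sub_eq_zero]
  let B : Submodule A s.F := W.map (LinearMap.fst A _ _)
  obtain ⟨l, p, hp⟩ := Module.Finite.exists_fin' A B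
  let q := p ∘ₗ (LinearEquiv.funCongrLeft A A (Equiv.ulift.{u} (α := Fin l)).symm).toLinearMap
  have hq : Function.Surjective q := hp.comp (LinearEquiv.surjective _)
  let r : W →ₗ[A] B := ((LinearMap.fst A _ _).restrict (fun w hw => Submodule.mem_map_of_mem hw))
  have hr : Function.Surjective r := by
    rintro ⟨_, w, hw, rfl⟩
    exact ⟨⟨w, hw⟩, rfl⟩
  obtain ⟨g₁, hg₁⟩ := Module.projective_lifting_property r q hr
  let F' := (ULift.{u} (Fin l) → A) × (ULift.{u} (Fin k) → A)
  let δ : F' →ₗ[A] s.F := LinearMap.fst A _ _ ∘ₗ W.subtype ∘ₗ g₁ ∘ₗ LinearMap.fst A _ _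
  let ψ : F' →ₗ[A] D.X (i + 1) :=
    LinearMap.snd A _ _ ∘ₗ W.subtype ∘ₗ g₁ ∘ₗ LinearMap.fst A _ _ +
      (g ≫ D.iCycles (i + 1)).hom ∘ₗ LinearMap.snd A _ _
  have hδ (x : F') : δ x = (g₁ x.1).1.1 := rfl
  have hψ (x : F') : ψ x = (g₁ x.1).1.2 + (D.iCycles (i + 1)).hom (g.hom x.2) := rfl
  have hδψ (x : F') : (D.d (i + 1) i).hom (ψ x) = s.φ.hom (δ x) := by
    rw [hδ, hψ, map_add, d_iCycles, add_zero]
    exact ((hW _).1 (g₁ x.1).2).2.symm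
  have hnext : (ComplexShape.down ℕ).next (i + 1) = i := by simp
  let t : ResolutionStage D (i + 1) :=
    { F := ModuleCat.of A F'
      finite := inferInstanceAs (Module.Finite A F')
      projective := inferInstanceAs (Module.Projective A F')
      φ := ModuleCat.ofHom ψ
      Z := LinearMap.ker δ
      d_φ := by
        intro z hz
        rw [hnext]
        exact (hδψ z).trans ((congrArg s.φ.hom hz).trans (map_zero _))
      exists_of_d_eq_zero := by
        intro c hc
        obtain ⟨z, rfl⟩ := exists_iCycles_eq D rfl c hc
        obtain ⟨x, hx⟩ := hg (D.homologyπ (i + 1) z)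
        have h1 : (D.homologyπ (i + 1)).hom (z - g.hom x) = 0 := by
          rw [map_sub, sub_eq_zero]
          exact hx.symm
        rw [homologyπ_eq_zero_iff D (i := i + 1 + 1) (by simp)] at h1
        obtain ⟨e, he⟩ := h1
        refine ⟨((0, x) : F'), ?_, e, ?_⟩
        · change δ (0, x) = 0
          rw [hδ]
          simp
        · rw [he, map_sub]
          change ψ (0, x) + _ = _
          rw [hψ]
          simp }
  refine ⟨t, ⟨{ d := ModuleCat.ofHom δ, d_mem := fun x => ((hW _).1 (g₁ x.1).2).1,
                mem_iff := fun x => Iff.rfl, comm := ?_, exists_d_eq := ?_ }⟩⟩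
  · refine ModuleCat.hom_ext (LinearMap.ext fun x => ?_)
    exact (hδψ x).symm
  · intro z hz c hc
    obtain ⟨y, hy⟩ := hq ⟨z, ⟨(z, c), (hW _).2 ⟨hz, hc⟩, rfl⟩⟩
    refine ⟨((y, 0) : F'), ?_⟩
    change δ (y, 0) = z
    rw [hδ]
    have : r (g₁ y) = q y := congr($hg₁ y)
    rw [hy] at this
    exact congr(($this).1)

/-- A chain complex of modules over a noetherian ring with finitely generated homology has a
resolution by finitely generated projective modules. -/
theorem exists_quasiIso_finite_projective [IsNoetherianRing A]
    [hD : ∀ i, Module.Finite A (D.homology i)] :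
    ∃ (P : ChainComplex (ModuleCat.{u} A) ℕ) (f : P ⟶ D),
      (∀ i, Module.Finite A (P.X i) ∧ Module.Projective A (P.X i)) ∧ QuasiIso f := by
  let st : ∀ i, ResolutionStage D i := fun i =>
    Nat.rec (exists_resolutionStage_zero D).choose
      (fun i s => (exists_resolutionStep D i s).choose) i
  let δ (i : ℕ) : ResolutionStep D (st i) (st (i + 1)) :=
    (exists_resolutionStep D i (st i)).choose_spec.some
  have hδ (i : ℕ) : (δ (i + 1)).d ≫ (δ i).d = 0 := by
    ext x
    exact ((δ i).mem_iff _).1 ((δ (i + 1)).d_mem x)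
  let P := ChainComplex.of (fun i => (st i).F) (fun i => (δ i).d) hδ
  have hPd (i : ℕ) : P.d (i + 1) i = (δ i).d :=
    ChainComplex.of_d (fun i => (st i).F) (fun i => (δ i).d) i
  let f : P ⟶ D :=
    { f := fun i => (st i).φ
      comm' := by
        rintro _ i rfl
        rw [hPd]
        exact (δ i).comm.symm }
  refine ⟨P, f, fun i => ⟨(st i).finite, (st i).projective⟩, ⟨fun i => ?_⟩⟩
  have hZ (i : ℕ) (x : P.X i) (hx : (P.d i ((ComplexShape.down ℕ).next i)).hom x = 0) :
      x ∈ (st i).Z := by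
    cases i with
    | zero =>
      rw [show (st 0).Z = ⊤ from (exists_resolutionStage_zero D).choose_spec]
      trivial
    | succ i =>
      rw [show (ComplexShape.down ℕ).next (i + 1) = i by simp, hPd] at hx
      exact ((δ i).mem_iff x).2 hx
  have hZ' (i : ℕ) (x : P.X i) (hx : x ∈ (st i).Z) :
      (P.d i ((ComplexShape.down ℕ).next i)).hom x = 0 := by
    cases i with
    | zero => rw [P.shape _ _ (by simp)]; rfl
    | succ i =>
      rw [show (ComplexShape.down ℕ).next (i + 1) = i by simp, hPd]
      exact ((δ i).mem_iff x).1 hx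
  refine quasiIsoAt_of_elements f (i := i + 1) (by simp) rfl ?_ ?_
  · intro x hx y hy
    rw [hPd]
    exact (δ i).exists_d_eq x (hZ i x hx) y hy.symm
  · intro y hy
    obtain ⟨z, hz, e, he⟩ := (st i).exists_of_d_eq_zero y hy
    exact ⟨z, e, hZ' i z hz, he⟩

end Resolution

lemma IsCompactObjIn.of_iso {T : Type u} [Category.{w} T] [Preadditive T] {S : Set T} {E E' : T}
    (hE : IsCompactObjIn S E) (i : E ≅ E') : IsCompactObjIn S E' := by
  intro J _ Y _ hY
  refine ⟨coproductComparison_injective E' Y, fun f => ?_⟩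
  obtain ⟨d, hd⟩ := (hE J Y hY).2 (i.hom ≫ f)
  obtain rfl : i.inv ≫ coproductComparison E Y d = f := by simp [hd]
  clear hd
  change _ ∈ (coproductComparison E' Y).range
  induction d using DirectSum.induction_on with
  | zero => simp
  | of j f => exact ⟨DirectSum.of _ j (i.inv ≫ f), by simp [coproductComparison_of]⟩
  | add x y hx hy =>
    rw [map_add, Preadditive.comp_add]
    exact add_mem hx hy

section BoundedAbove

variable {A : Type u} [CommRing A]

open ComplexShape

/-- A bounded above complex with finitely generated homology has a bounded above resolution by
finitely generated projective modules. -/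
lemma exists_quasiIso_of_isStrictlyLE [IsNoetherianRing A]
    (C : CochainComplex (ModuleCat.{u} A) ℤ) (b : ℤ) [C.IsStrictlyLE b]
    (hC : ∀ n, Module.Finite A (C.homology n)) :
    ∃ (P : CochainComplex (ModuleCat.{u} A) ℤ) (f : P ⟶ C), P.IsStrictlyLE b ∧ QuasiIso f ∧
      ∀ n, Module.Finite A (P.X n) ∧ Module.Projective A (P.X n) := by
  let e := embeddingUpIntLE b
  let D := C.restriction e
  let g : C ⟶ D.extend e := e.liftExtend (𝟙 D) fun j hj => hj.false_of_isTruncLE.elim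
  have hg (n : ℤ) : IsIso (g.f n) := by
    by_cases hn : ∃ i, e.f i = n
    · obtain ⟨i, hi⟩ := hn
      refine (e.isIso_liftExtend_f_iff (𝟙 D) _ hi).2 ?_
      change IsIso (𝟙 (D.X i))
      infer_instance
    · push Not at hn
      have h₁ := HomologicalComplex.isZero_X_of_isStrictlySupported C e n hn
      have h₂ := D.isZero_extend_X e n hn
      exact ⟨0, h₁.eq_of_src _ _, h₂.eq_of_src _ _⟩
  have : IsIso g := HomologicalComplex.Hom.isIso_of_components g
  have hD (i : ℕ) : Module.Finite A (D.homology i) := by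
    have i₁ := D.extendHomologyIso e (j := i) rfl
    have i₂ := (HomologicalComplex.homologyFunctor _ _ (e.f i)).mapIso (asIso g)
    have : Module.Finite A
      ((HomologicalComplex.homologyFunctor (ModuleCat.{u} A) (up ℤ) (e.f i)).obj C) := hC (e.f i)
    exact Module.Finite.equiv (i₂ ≪≫ i₁).toLinearEquiv
  obtain ⟨P, f, hP, hf⟩ := exists_quasiIso_finite_projective D
  refine ⟨P.extend e, HomologicalComplex.extendMap f e ≫ inv g, inferInstance, inferInstance,
    fun n => ?_⟩
  by_cases hn : ∃ i, e.f i = n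
  · obtain ⟨i, hi⟩ := hn
    have k := (P.extendXIso e hi).symm.toLinearEquiv
    have := (hP i).1
    have := (hP i).2
    exact ⟨Module.Finite.equiv k, Module.Projective.of_equiv k⟩
  · push Not at hn
    have := ModuleCat.subsingleton_of_isZero (P.isZero_extend_X e n hn)
    exact ⟨inferInstance, inferInstance⟩

end BoundedAbove

section CompactResolution

open DerivedCategory

variable {A : Type u} [CommRing A] [HasDerivedCategory.{w} (ModuleCat.{u} A)] {I : Ideal A}

lemma mem_DTor_of_iso {X Y : DerivedCategory (ModuleCat.{u} A)} (i : X ≅ Y) (hX : X ∈ DTor I) :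
    Y ∈ DTor I := fun n =>
  (hX n).of_injective (((homologyFunctor _ n).mapIso i.symm).toLinearEquiv.toLinearMap)
    (LinearEquiv.injective _)

variable [IsNoetherianRing A]

/-- A compact object of `DTor I` is represented by a bounded above complex of finitely generated
projective modules. -/
lemma IsCompactObjIn.exists_iso_bounded_above {M : DerivedCategory (ModuleCat.{u} A)}
    (hM : IsCompactObjIn (DTor I) M) (hMI : M ∈ DTor I) :
    ∃ (P : CochainComplex (ModuleCat.{u} A) ℤ) (b : ℤ), P.IsStrictlyLE b ∧
      (∀ n, Module.Finite A (P.X n) ∧ Module.Projective A (P.X n)) ∧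
      Nonempty (M ≅ Q.obj P) := by
  let C := Q.objPreimage M
  let i : Q.obj C ≅ M := Q.objObjPreimageIso M
  obtain ⟨b, hb⟩ := (finite_setOf_homology_ne_zero (hM.of_iso i.symm) (mem_DTor_of_iso i.symm hMI)).bddAbove
  have : (Q.obj C).IsLE b := by
    rw [isLE_Q_obj_iff, CochainComplex.isLE_iff]
    intro n hn
    rw [HomologicalComplex.exactAt_iff_isZero_homology, ModuleCat.isZero_iff_subsingleton]
    by_contra h
    exact (hb h).not_gt hn
  obtain ⟨C', _, ⟨i'⟩⟩ := (Q.obj C).exists_iso_Q_obj_of_isLE b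
  let k := i.symm ≪≫ i'
  obtain ⟨P, f, hP, hf, hfin⟩ := exists_quasiIso_of_isStrictlyLE C' b fun n =>
    have := isNoetherian_homology (hM.of_iso k) (mem_DTor_of_iso k hMI) n
    inferInstance
  exact ⟨P, b, hP, hfin, ⟨k ≪≫ (asIso (Q.map f)).symm⟩⟩

end CompactResolution

section Extension

variable {A : Type u} [CommRing A] {P : CochainComplex (ModuleCat.{u} A) ℤ} {n : ℤ}

/-- If a morphism to a complex concentrated in one degree is null-homotopic, then it extends along
the differential. -/
lemma exists_d_comp_eq_of_homotopy {T : ModuleCat.{u} A} (g : P.X n ⟶ T)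
    (hg : P.d (n - 1) n ≫ g = 0) (H : Homotopy (toSingle g hg) 0) :
    ∃ h : P.X (n + 1) ⟶ T, P.d n (n + 1) ≫ h = g := by
  refine ⟨H.hom (n + 1) n ≫ (HomologicalComplex.singleObjXSelf _ n T).hom, ?_⟩
  have h := H.comm n
  rw [dNext_eq H.hom (show (ComplexShape.up ℤ).Rel n (n + 1) from rfl),
    prevD_eq H.hom (show (ComplexShape.up ℤ).Rel (n - 1) n from by simp),
    HomologicalComplex.single_obj_d, comp_zero, toSingle_f_self] at h
  rw [← cancel_mono (HomologicalComplex.singleObjXSelf (ComplexShape.up ℤ) n T).inv, h]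
  simp

/-- If `a` acts nilpotently on the homology of a bounded above complex of projective modules,
then the complex is contractible up to a power of `a`. -/
lemma exists_d_smul_eq {b : ℤ} [P.IsStrictlyLE b] (hP : ∀ n, Module.Projective A (P.X n)) (a : A)
    (ha : ∀ n, ∃ k : ℕ, ∀ x : P.homology n, a ^ k • x = 0) (n : ℤ) :
    ∃ (K : ℕ) (t : P.X (n + 1) ⟶ P.X n), ∀ x : P.X n,
      (P.d n (n + 1)).hom (t.hom ((P.d n (n + 1)).hom x)) = a ^ K • (P.d n (n + 1)).hom x := by
  obtain ⟨m, hm⟩ : ∃ m : ℕ, b < n + m := ⟨(b + 1 - n).toNat, by omega⟩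
  induction m generalizing n with
  | zero =>
    have := ModuleCat.subsingleton_of_isZero (P.isZero_of_isStrictlyLE b n (by simpa using hm))
    refine ⟨0, 0, fun x => ?_⟩
    rw [Subsingleton.elim x 0]
    simp
  | succ m ih =>
    obtain ⟨K, t, ht⟩ := ih (n + 1) (by push_cast at hm; omega)
    obtain ⟨k, hk⟩ := ha (n + 1)
    let s : P.X (n + 1) →ₗ[A] P.X (n + 1) :=
      a ^ K • LinearMap.id - t.hom ∘ₗ (P.d (n + 1) (n + 1 + 1)).hom
    have hs (x) : s x = a ^ K • x - t.hom ((P.d (n + 1) (n + 1 + 1)).hom x) := rfl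
    let D : P.X n →ₗ[A] P.X (n + 1) := (P.d n (n + 1)).hom
    have hD (x) : (P.d (n + 1) (n + 1 + 1)).hom (D x) = 0 :=
      congr($(P.d_comp_d n (n + 1) (n + 1 + 1)).hom x)
    have hmem (x) : (a ^ k • s) x ∈ LinearMap.range D := by
      have h0 : (P.d (n + 1) (n + 1 + 1)).hom (s x) = 0 := by
        rw [hs, map_sub, map_smul, ht, sub_self]
      obtain ⟨z, hz⟩ := exists_iCycles_eq P (by simp) _ h0
      have h1 : (P.homologyπ (n + 1)).hom (a ^ k • z) = 0 := by rw [map_smul, hk]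
      obtain ⟨y, hy⟩ := (homologyπ_eq_zero_iff P (i := n) (by simp) _).1 h1
      refine ⟨y, hy.trans ?_⟩
      rw [map_smul, hz]
      rfl
    have := hP (n + 1)
    obtain ⟨r, hr⟩ := Module.projective_lifting_property D.rangeRestrict
      ((a ^ k • s).codRestrict _ hmem) D.surjective_rangeRestrict
    have hr' (x) : D (r x) = a ^ k • s x := congr(($hr x).1)
    refine ⟨k + K, ModuleCat.ofHom r, fun x => ?_⟩
    refine (hr' (D x)).trans ?_
    rw [hs, hD, map_zero, sub_zero, smul_smul, pow_add]

/-- Under the same assumptions, morphisms to a module on which `a` is invertible extend along the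
differential. -/
lemma exists_d_comp_eq_of_isUnit {b : ℤ} [P.IsStrictlyLE b]
    (hP : ∀ n, Module.Projective A (P.X n)) (a : A)
    (ha : ∀ n, ∃ k : ℕ, ∀ x : P.homology n, a ^ k • x = 0) {T : ModuleCat.{u} A}
    (hT : IsUnit (algebraMap A (Module.End A T) a)) (g : P.X n ⟶ T)
    (hg : P.d (n - 1) n ≫ g = 0) : ∃ h : P.X (n + 1) ⟶ T, P.d n (n + 1) ≫ h = g := by
  obtain ⟨K, t, ht⟩ := exists_d_smul_eq (b := b) hP a ha n
  obtain ⟨k, hk⟩ := ha n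
  have hT' (k : ℕ) : IsUnit (algebraMap A (Module.End A T) (a ^ k)) := by
    rw [map_pow]
    exact hT.pow k
  have hinj (k : ℕ) {x y : T} (h : a ^ k • x = a ^ k • y) : x = y :=
    ((Module.End.isUnit_iff _).1 (hT' k)).1 h
  have key (x : P.X n) (hx : (P.d n (n + 1)).hom x = 0) : g.hom x = 0 := by
    obtain ⟨z, rfl⟩ := exists_iCycles_eq P (by simp) _ hx
    have h1 : (P.homologyπ n).hom (a ^ k • z) = 0 := by rw [map_smul, hk]
    obtain ⟨y, hy⟩ := (homologyπ_eq_zero_iff P (i := n - 1) (by simp) _).1 h1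
    apply hinj k
    rw [smul_zero, ← map_smul, ← map_smul, ← hy]
    exact congr($(hg).hom y)
  obtain ⟨v, hv, -⟩ := isUnit_iff_exists.1 (hT' K)
  refine ⟨ModuleCat.ofHom (v ∘ₗ g.hom ∘ₗ t.hom), ModuleCat.hom_ext (LinearMap.ext fun x => ?_)⟩
  change v (g.hom (t.hom ((P.d n (n + 1)).hom x))) = g.hom x
  apply hinj K
  refine (congr($hv (g.hom (t.hom ((P.d n (n + 1)).hom x))))).trans ?_
  change g.hom (t.hom ((P.d n (n + 1)).hom x)) = _
  rw [← map_smul, ← sub_eq_zero, ← map_sub]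
  apply key
  rw [map_sub, ht, map_smul, sub_self]

end Extension

section CompactExtension

open DerivedCategory

variable {A : Type u} [CommRing A] [HasDerivedCategory.{w} (ModuleCat.{u} A)] {I : Ideal A}
  {P : CochainComplex (ModuleCat.{u} A) ℤ}

/-- If `P` is compact in `DTor I`, then morphisms from `P` to residue fields at maximal ideals
containing `I` extend along the differential in all sufficiently small degrees. -/
lemma exists_forall_exists_d_comp_eq [P.IsKProjective]
    (hP : IsCompactObjIn (DTor I) (Q.obj P)) :
    ∃ N : ℤ, ∀ n < N, ∀ (m : Ideal A) [m.IsMaximal], I ≤ m →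
      ∀ g : P.X n ⟶ residueFieldModule m, P.d (n - 1) n ≫ g = 0 →
        ∃ h : P.X (n + 1) ⟶ residueFieldModule m, P.d n (n + 1) ≫ h = g := by
  let S : Set ℤ := {n | ∃ (m : Ideal A) (_ : m.IsMaximal) (_ : I ≤ m)
    (g : P.X n ⟶ residueFieldModule m) (_ : P.d (n - 1) n ≫ g = 0),
      ¬ ∃ h : P.X (n + 1) ⟶ residueFieldModule m, P.d n (n + 1) ≫ h = g}
  have hS : S.Finite := by
    choose m hm hIm g hg hbad using fun j : S => j.2
    have h1 := finite_setOf_Q_map_ne_zero hP _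
      (fun j => Q_single_mem_DTor j.1 (isTorsionWrt_residueFieldModule (m j) (hIm j)))
      (fun j => toSingle (g j) (hg j))
      (finite_setOf_toSingle_f_ne_zero _ Subtype.val_injective _ _ _)
    have h2 : {j : S | Q.map (toSingle (g j) (hg j)) ≠ 0} = Set.univ := by
      refine Set.eq_univ_of_forall fun j h => ?_
      obtain ⟨H⟩ := nonempty_homotopy_zero_of_Q_map_eq_zero _ h
      exact hbad j (exists_d_comp_eq_of_homotopy _ _ H)
    rw [h2, Set.finite_univ_iff] at h1
    exact Set.toFinite S
  obtain ⟨N, hN⟩ := hS.bddBelow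
  refine ⟨N, fun n hn m hm hIm g hg => ?_⟩
  by_contra h
  exact (hN (show n ∈ S from ⟨m, hm, hIm, g, hg, h⟩)).not_gt hn

/-- A compact object of `DTor I` represented by a bounded above complex of finitely generated
projective modules has projective cokernels of differentials in sufficiently small degrees. -/
lemma exists_forall_projective_quotient_range [IsNoetherianRing A] {b : ℤ} [P.IsStrictlyLE b]
    (hPX : ∀ n, Module.Finite A (P.X n) ∧ Module.Projective A (P.X n))
    (hP : IsCompactObjIn (DTor I) (Q.obj P)) (hPI : Q.obj P ∈ DTor I) :
    ∃ N : ℤ, ∀ n < N,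
      Module.Projective A (P.X (n + 1) ⧸ LinearMap.range (P.d n (n + 1)).hom) := by
  have (n : ℤ) : Projective (P.X n) :=
    have := (hPX n).2
    (IsProjective.iff_projective (R := A) (P.X n)).1 this
  have := CochainComplex.isKProjective_of_projective P b
  obtain ⟨N, hN⟩ := exists_forall_exists_d_comp_eq hP
  refine ⟨N, fun n hn => ?_⟩
  have := (hPX (n + 1)).1
  have := (hPX (n + 1)).2
  refine projective_quotient_of_extend _ fun m _ φ => ?_
  let g : P.X n ⟶ residueFieldModule m := ModuleCat.ofHom (φ ∘ₗ (P.d n (n + 1)).hom.rangeRestrict)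
  have hg : P.d (n - 1) n ≫ g = 0 := by
    refine ModuleCat.hom_ext (LinearMap.ext fun x => ?_)
    change φ ((P.d n (n + 1)).hom.rangeRestrict ((P.d (n - 1) n).hom x)) = 0
    rw [show (P.d n (n + 1)).hom.rangeRestrict ((P.d (n - 1) n).hom x) = 0 from
      Subtype.ext congr($(P.d_comp_d (n - 1) n (n + 1)).hom x), map_zero]
  obtain ⟨h, hh⟩ : ∃ h : P.X (n + 1) ⟶ residueFieldModule m, P.d n (n + 1) ≫ h = g := by
    by_cases hIm : I ≤ m
    · exact hN n hn m hIm g hg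
    · obtain ⟨a, haI, ham⟩ := SetLike.not_le_iff_exists.1 hIm
      refine exists_d_comp_eq_of_isUnit (b := b) (fun n => (hPX n).2) a (fun n => ?_) ?_ g hg
      · have := isNoetherian_homology hP hPI n
        obtain ⟨k, hk⟩ := ((Q_obj_mem_DTor_iff I).1 hPI n).exists_pow_smul_eq_zero
        exact ⟨k, hk _ (Ideal.pow_mem_pow haI k)⟩
      · have := (isUnit_algebraMap_residueField m ham).map
          (Algebra.lmul A (IsLocalRing.ResidueField (Localization.AtPrime m)))
        rwa [AlgHom.commutes] at this
  refine ⟨h.hom, LinearMap.ext ?_⟩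
  rintro ⟨_, x, rfl⟩
  exact congr($(hh).hom x)

end CompactExtension

section Truncation

variable {A : Type u} [CommRing A] (P : CochainComplex (ModuleCat.{u} A) ℤ)

/-- The canonical truncation of a bounded above complex of finitely generated projective modules
at a projective cokernel is a bounded complex of finitely generated projective modules. -/
lemma isBoundedComplexOfFinProj_truncGE {b : ℤ} [P.IsStrictlyLE b]
    (hP : ∀ n, Module.Finite A (P.X n) ∧ Module.Projective A (P.X n)) (n : ℤ)
    (hn : Module.Projective A (P.X (n + 1) ⧸ LinearMap.range (P.d n (n + 1)).hom)) :
    IsBoundedComplexOfFinProj (P.truncGE (n + 1)) := by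
  have := (hP (n + 1)).1
  let k : (P.X (n + 1) ⧸ LinearMap.range (P.d n (n + 1)).hom) ≃ₗ[A] P.opcycles (n + 1) :=
    (Submodule.quotEquivOfEq _ (LinearMap.ker (P.pOpcycles (n + 1)).hom) (by
      ext x
      exact (pOpcycles_eq_zero_iff P (i := n) (by simp) x).symm)).trans
      (LinearMap.quotKerEquivOfSurjective _ (pOpcycles_surjective P (n + 1)))
  have h₁ (i : ℤ) (hi : n + 1 < i) := (P.truncGEXIso (n + 1) i hi).symm.toLinearEquiv
  have h₂ := (P.truncGEXIsoOpcycles (n + 1)).symm.toLinearEquiv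
  have h₃ (i : ℤ) (hi : i < n + 1) := (P.truncGE (n + 1)).isZero_of_isStrictlyGE (n + 1) i hi
  refine ⟨fun i => ?_, n + 1, max b (n + 1), fun i hi => ?_⟩
  · obtain hi | rfl | hi := lt_trichotomy i (n + 1)
    · have := ModuleCat.subsingleton_of_isZero (h₃ i hi)
      exact ⟨inferInstance, inferInstance⟩
    · exact ⟨Module.Finite.equiv (k.trans h₂), Module.Projective.of_equiv (k.trans h₂)⟩
    · have := (hP i).1
      have := (hP i).2
      exact ⟨Module.Finite.equiv (h₁ i hi), Module.Projective.of_equiv (h₁ i hi)⟩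
  · obtain hi | hi := hi
    · exact h₃ i hi
    · exact (P.isZero_of_isStrictlyLE b i (by omega)).of_iso (P.truncGEXIso (n + 1) i (by omega))

end Truncation

theorem compact_in_DTor_iff_iso_bounded_complex_of_finite_projectives
    {A : Type u} [CommRing A] [IsNoetherianRing A]
    [HasDerivedCategory.{w} (ModuleCat.{u} A)] (I : Ideal A)
    (M : DerivedCategory (ModuleCat.{u} A)) (hM : M ∈ DTor I) :
    IsCompactObjIn (DTor I) M ↔
    ∃ K : CochainComplex (ModuleCat.{u} A) ℤ,
      IsBoundedComplexOfFinProj K ∧ Nonempty (M ≅ DerivedCategory.Q.obj K) := by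
  refine ⟨fun hC => ?_, fun ⟨K, hK, ⟨i⟩⟩ => isCompactObjIn_of_isBoundedComplexOfFinProj hK _ i⟩
  obtain ⟨P, b, _, hP, ⟨i⟩⟩ := hC.exists_iso_bounded_above hM
  have hPC := hC.of_iso i
  have hPM := mem_DTor_of_iso i hM
  obtain ⟨N, hN⟩ := exists_forall_projective_quotient_range (b := b) hP hPC hPM
  obtain ⟨N', hN'⟩ := (finite_setOf_homology_ne_zero hPC hPM).bddBelow
  let n := min N N' - 1
  have : P.IsGE (n + 1) := by
    rw [CochainComplex.isGE_iff]
    intro j hj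
    rw [HomologicalComplex.exactAt_iff_isZero_homology, ModuleCat.isZero_iff_subsingleton]
    by_contra h
    have := hN' h
    omega
  exact ⟨P.truncGE (n + 1), isBoundedComplexOfFinProj_truncGE (b := b) P hP n (hN n (by omega)),
    ⟨i ≪≫ asIso (DerivedCategory.Q.map (P.πTruncGE (n + 1)))⟩⟩
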